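/- The center of H is equal to the unital C-subalgebra of H generated by the elements c_ij, 0 ≤ i,j ≤ N. -/

import Mathlib

open MvPolynomial

noncomputable section

abbrev Rzl (N : ℕ) := MvPolynomial (Fin N ⊕ Fin N) ℂ

def permHat (N : ℕ) (σ : Equiv.Perm (Fin N)) : Rzl N ≃ₐ[ℂ] Rzl N :=
  renameEquiv ℂ (Equiv.sumCongr σ σ)

/-- The automorphism `σ̂` as an endomorphism of `ℂ[z,λ]`. -/
def permOp (N : ℕ) (σ : Equiv.Perm (Fin N)) : Module.End ℂ (Rzl N) :=
  (permHat N σ).toLinearMap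

/-- The automorphism `s_ij^z` exchanging `z_i ↔ z_j` only. -/
def sZ (N : ℕ) (i j : Fin N) : Rzl N ≃ₐ[ℂ] Rzl N :=
  renameEquiv ℂ (Equiv.sumCongr (Equiv.swap i j) (Equiv.refl (Fin N)))

/-- The automorphism `s_ij^λ` exchanging `λ_i ↔ λ_j` only. -/
def sL (N : ℕ) (i j : Fin N) : Rzl N ≃ₐ[ℂ] Rzl N :=
  renameEquiv ℂ (Equiv.sumCongr (Equiv.refl (Fin N)) (Equiv.swap i j))

/-- Multiplication by a polynomial, as an endomorphism of `ℂ[z,λ]`. -/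
def mulP (N : ℕ) (p : Rzl N) : Module.End ℂ (Rzl N) := LinearMap.mulLeft ℂ p

/-- Product of the endomorphisms `f i`, `i ∈ T`, taken in increasing order of `i`
(the order is irrelevant when the factors pairwise commute). -/
def ordProd {N : ℕ} (T : Finset (Fin N)) (f : Fin N → Module.End ℂ (Rzl N)) :
    Module.End ℂ (Rzl N) :=
  ((T.sort (· ≤ ·)).map f).prod

/-- The universal central polynomial evaluated at `(u,v)`:
`P(u,v) = (−1)^N Σ_σ sgn(σ) (Σ_{T ⊆ Fix σ} (−1)^{|T|} (Π_{i∈T}(v−λ_i))·(Π_{i∈T}(u−K_i))) ∘ σ̂`. -/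
def Puv {N : ℕ} (K : Fin N → Module.End ℂ (Rzl N)) (u v : ℂ) : Module.End ℂ (Rzl N) :=
  ((-1 : ℤ) ^ N) • ∑ σ : Equiv.Perm (Fin N), (Equiv.Perm.sign σ : ℤ) •
    ((∑ T ∈ (Finset.univ.filter fun i => σ i = i).powerset,
        ((-1 : ℤ) ^ T.card) •
          (mulP N (∏ i ∈ T, ((C v : Rzl N) - X (Sum.inr i))) *
            ordProd T (fun i => u • (1 : Module.End ℂ (Rzl N)) - K i))) * permOp N σ)

set_option synthInstance.maxHeartbeats 1000000 in

/-- The realization `H` of the rational Cherednik algebra: the unital subalgebra of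
`End_ℂ(ℂ[z,λ])` generated by the multiplications by `λ_1,…,λ_N`, the operators
`K_1,…,K_N` and the automorphisms `σ̂`. -/
def cherednik (N : ℕ) (K : Fin N → Module.End ℂ (Rzl N)) :
    Subalgebra ℂ (Module.End ℂ (Rzl N)) :=
  Algebra.adjoin ℂ
    ((Set.range fun i => mulP N (X (Sum.inr i))) ∪ Set.range K ∪ Set.range (permOp N))

open Equiv in
/-- The defining relations of the rational Cherednik algebra of `S_N` at `t = 0`. -/
structure CherednikRel {N : ℕ} {A : Type*} [Ring A] (x y : Fin N → A)
    (S : Perm (Fin N) →* A) : Prop where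
  xx : ∀ i j, x i * x j = x j * x i
  yy : ∀ i j, y i * y j = y j * y i
  Sx : ∀ τ i, S τ * x i = x (τ i) * S τ
  Sy : ∀ τ i, S τ * y i = y (τ i) * S τ
  yx_ne : ∀ i k, i ≠ k → y i * x k = x k * y i - S (swap i k)
  yx_eq : ∀ k, y k * x k = x k * y k + ∑ j ∈ Finset.univ.erase k, S (swap k j)

/-- `X T` is the product of the `x i` over `i ∈ T`. -/
structure IsFinsetProd {N : ℕ} {A : Type*} [Ring A] (x : Fin N → A)
    (X : Finset (Fin N) → A) : Prop where
  empty : X ∅ = 1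
  insert : ∀ i T, i ∉ T → X (insert i T) = x i * X T

open Equiv in
/-- The universal central element, up to sign. -/
def centralElt {N : ℕ} {A : Type*} [Ring A] (X Y : Finset (Fin N) → A)
    (S : Perm (Fin N) →* A) : A :=
  ∑ T : Finset (Fin N), ∑ σ : Perm (Fin N) with ∀ i ∈ T, σ i = i,
    ((Perm.sign σ : ℤ) * (-1) ^ T.card) • (X T * Y T * S σ)

namespace IsFinsetProd

variable {N : ℕ} {A : Type*} [Ring A] {x : Fin N → A} {X : Finset (Fin N) → A}

theorem erase (hX : IsFinsetProd x X) {i : Fin N} {T : Finset (Fin N)} (hi : i ∈ T) :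
    X T = x i * X (T.erase i) := by
  rw [← hX.insert i _ (Finset.notMem_erase i T), Finset.insert_erase hi]

theorem commute (hX : IsFinsetProd x X) {a : A} {T : Finset (Fin N)}
    (h : ∀ i ∈ T, a * x i = x i * a) : a * X T = X T * a := by
  induction T using Finset.induction_on with
  | empty => simp [hX.empty]
  | insert i T hi ih =>
    rw [hX.insert i T hi, ← mul_assoc, h i (by simp), mul_assoc,
      ih fun j hj => h j (by simp [hj]), mul_assoc]

theorem perm_mul (hX : IsFinsetProd x X) {S : Equiv.Perm (Fin N) →* A}
    (hS : ∀ τ i, S τ * x i = x (τ i) * S τ) (τ : Equiv.Perm (Fin N)) (T : Finset (Fin N)) :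
    S τ * X T = X (T.map τ.toEmbedding) * S τ := by
  induction T using Finset.induction_on with
  | empty => simp [hX.empty]
  | insert i T hi ih =>
    rw [hX.insert i T hi, Finset.map_insert, hX.insert _ _ (by simpa using hi), ← mul_assoc, hS,
      mul_assoc, ih, mul_assoc]
    rfl

theorem perm_commute (hX : IsFinsetProd x X) {S : Equiv.Perm (Fin N) →* A}
    (hS : ∀ τ i, S τ * x i = x (τ i) * S τ) {τ : Equiv.Perm (Fin N)} {T : Finset (Fin N)}
    (hT : ∀ i ∈ T, τ i = i) : S τ * X T = X T * S τ :=
  hX.commute fun i hi => by rw [hS, hT i hi]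

end IsFinsetProd

namespace CherednikRel

open Equiv

variable {N : ℕ} {A : Type*} [Ring A] {x y : Fin N → A} {S : Perm (Fin N) →* A}
  {X Y : Finset (Fin N) → A}

theorem prod_mul_of_notMem (h : CherednikRel x y S) (hY : IsFinsetProd y Y) {k : Fin N}
    {T : Finset (Fin N)} (hk : k ∉ T) :
    Y T * x k = x k * Y T - ∑ i ∈ T, Y (T.erase i) * S (swap i k) := by
  induction T using Finset.induction_on with
  | empty => simp [hY.empty]
  | insert a T ha ih =>
    have hka : k ≠ a := fun e => hk (by simp [e])
    have hkT : k ∉ T := fun e => hk (by simp [e])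
    have h1 : ∑ i ∈ T, Y ((insert a T).erase i) * S (swap i k)
        = ∑ i ∈ T, y a * (Y (T.erase i) * S (swap i k)) :=
      Finset.sum_congr rfl fun i hi => by
        have hia : i ≠ a := fun e => ha (e ▸ hi)
        rw [Finset.erase_insert_of_ne hia.symm,
          hY.insert a _ (fun e => ha (Finset.mem_of_mem_erase e)), mul_assoc]
    rw [Finset.sum_insert ha, Finset.erase_insert ha, h1, ← Finset.mul_sum, hY.insert a T ha,
      mul_assoc, ih hkT, mul_sub, ← mul_assoc, h.yx_ne a k hka.symm, sub_mul,
      hY.perm_commute h.Sy (τ := swap a k) (T := T), mul_assoc]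
    · abel
    · intro i hi
      exact swap_apply_of_ne_of_ne (fun e => ha (e ▸ hi)) (fun e => hkT (e ▸ hi))

theorem prod_mul_of_mem (h : CherednikRel x y S) (hY : IsFinsetProd y Y) {k : Fin N}
    {T : Finset (Fin N)} (hk : k ∈ T) :
    Y T * x k = x k * Y T + ∑ j ∈ Tᶜ, Y (T.erase k) * S (swap k j) := by
  have hsplit : Finset.univ.erase k = T.erase k ∪ Tᶜ := by
    ext i; by_cases hi : i = k <;> simp [hi, hk, em]
  have hdis : Disjoint (T.erase k) Tᶜ := by
    rw [Finset.disjoint_left]; intro i hi; simp at hi ⊢; exact hi.2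
  have h1 : ∀ i ∈ T.erase k, S (swap k i) * Y (T.erase k)
      = y k * (Y ((T.erase k).erase i) * S (swap i k)) := fun i hi => by
    rw [hY.erase hi, ← mul_assoc, h.Sy, swap_apply_right, mul_assoc, hY.perm_commute h.Sy,
      swap_comm]
    intro j hj
    simp only [Finset.mem_erase] at hj
    exact swap_apply_of_ne_of_ne hj.2.1 hj.1
  have h2 : ∀ j ∈ Tᶜ, S (swap k j) * Y (T.erase k) = Y (T.erase k) * S (swap k j) :=
    fun j hj => hY.perm_commute h.Sy fun i hi => by
      simp only [Finset.mem_erase, Finset.mem_compl] at hi hj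
      exact swap_apply_of_ne_of_ne hi.1 (fun e => hj (e ▸ hi.2))
  rw [hY.erase hk, mul_assoc, h.prod_mul_of_notMem hY (Finset.notMem_erase k T), mul_sub,
    ← mul_assoc, h.yx_eq, add_mul, hsplit, Finset.sum_union hdis, add_mul, Finset.sum_mul,
    Finset.sum_mul, Finset.sum_congr rfl h1, Finset.sum_congr rfl h2, Finset.mul_sum, mul_assoc]
  abel

theorem centralElt_mul_x (h : CherednikRel x y S) (hX : IsFinsetProd x X)
    (hY : IsFinsetProd y Y) (k : Fin N) :
    centralElt X Y S * x k = x k * centralElt X Y S := by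
  have hxX : ∀ j T, x j * X T = X T * x j := fun j T => hX.commute fun i _ => h.xx j i
  let w : Perm (Fin N) → Finset (Fin N) → ℤ := fun σ T => (Perm.sign σ : ℤ) * (-1) ^ T.card
  let Ω : Finset ((_ : Finset (Fin N)) × Perm (Fin N)) :=
    Finset.univ.sigma fun T => Finset.univ.filter fun σ => ∀ i ∈ T, σ i = i
  have hΩ : ∀ p : (_ : Finset (Fin N)) × Perm (Fin N), p ∈ Ω ↔ ∀ i ∈ p.1, p.2 i = i := by
    intro p; simp [Ω]
  have hQ : centralElt X Y S = ∑ p ∈ Ω, w p.2 p.1 • (X p.1 * Y p.1 * S p.2) := by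
    rw [centralElt, Finset.sum_sigma']
  have hterm : ∀ p ∈ Ω, w p.2 p.1 • (X p.1 * Y p.1 * S p.2) * x k
      - x k * w p.2 p.1 • (X p.1 * Y p.1 * S p.2)
      = w p.2 p.1 • ((x (p.2 k) - x k) * (X p.1 * Y p.1 * S p.2))
        + ((∑ j ∈ p.1ᶜ, if k ∈ p.1 then
            w p.2 p.1 • (X p.1 * Y (p.1.erase k) * S (swap k j * p.2)) else 0)
          - ∑ i ∈ p.1, if p.2 k ∉ p.1 then
            w p.2 p.1 • (X p.1 * Y (p.1.erase i) * S (swap i (p.2 k) * p.2)) else 0) := by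
    rintro ⟨T, σ⟩ hp
    rw [hΩ] at hp
    simp only at hp ⊢
    have hkm : σ k ∈ T ↔ k ∈ T :=
      ⟨fun hm => by have := σ.injective (hp _ hm); rwa [this] at hm, fun hm => by rwa [hp _ hm]⟩
    have e1 : X T * Y T * S σ * x k = X T * (Y T * x (σ k)) * S σ := by
      rw [mul_assoc, h.Sx]; simp only [mul_assoc]
    rw [smul_mul_assoc, mul_smul_comm, ← smul_sub, e1, sub_mul, smul_sub, smul_sub]
    by_cases hk : k ∈ T
    · have hσ : σ k = k := hp k hk
      rw [hσ, h.prod_mul_of_mem hY hk]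
      simp only [hk, if_true, not_true_eq_false, if_false, Finset.sum_const_zero, sub_zero,
        sub_self, zero_add, mul_add, add_mul, smul_add, Finset.mul_sum, Finset.sum_mul,
        Finset.smul_sum, map_mul]
      rw [← mul_assoc (X T), ← hxX]
      simp only [mul_assoc, add_sub_cancel_left]
    · have hm : σ k ∉ T := fun e => hk (hkm.1 e)
      rw [h.prod_mul_of_notMem hY hm]
      simp only [hk, hm, not_false_eq_true, if_true, if_false, Finset.sum_const_zero, mul_sub,
        sub_mul, smul_sub, Finset.mul_sum, Finset.sum_mul, Finset.smul_sum, map_mul]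
      rw [← mul_assoc (X T), ← hxX]
      simp only [mul_assoc]
      abel
  have hA : ∑ p ∈ Ω, (∑ j ∈ p.1ᶜ, if k ∈ p.1 then
        w p.2 p.1 • (X p.1 * Y (p.1.erase k) * S (swap k j * p.2)) else 0)
      = ∑ p ∈ Ω, w p.2 p.1 • (if p.2 k ≠ k then x k * (X p.1 * Y p.1 * S p.2) else 0) := by
    simp only [smul_ite, smul_zero]
    rw [Finset.sum_sigma', ← Finset.sum_filter, ← Finset.sum_filter]
    refine Finset.sum_nbij' (fun q => ⟨q.1.1.erase k, swap k q.2 * q.1.2⟩)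
      (fun p => ⟨⟨insert k p.1, swap k (p.2 k) * p.2⟩, p.2 k⟩) ?_ ?_ ?_ ?_ ?_
    · rintro ⟨⟨T, σ⟩, j⟩ hq
      simp only [Finset.mem_filter, Finset.mem_sigma, hΩ, Finset.mem_compl] at hq ⊢
      obtain ⟨⟨hT, hj⟩, hk⟩ := hq
      have hjk : j ≠ k := fun e => hj (e ▸ hk)
      refine ⟨fun i hi => ?_, ?_⟩
      · simp only [Finset.mem_erase] at hi
        rw [Perm.mul_apply, hT i hi.2, swap_apply_of_ne_of_ne hi.1 (ne_of_mem_of_not_mem hi.2 hj)]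
      · rw [Perm.mul_apply, hT k hk, swap_apply_left]; exact hjk
    · rintro ⟨T, σ⟩ hp
      simp only [Finset.mem_filter, Finset.mem_sigma, hΩ, Finset.mem_compl] at hp ⊢
      obtain ⟨hT, hk⟩ := hp
      refine ⟨⟨fun i hi => ?_, ?_⟩, by simp⟩
      · rcases Finset.mem_insert.1 hi with rfl | hi
        · simp
        · have h1 := hT i hi
          rw [Perm.mul_apply, h1, swap_apply_of_ne_of_ne]
          · rintro rfl; exact hk h1
          · intro e; exact hk (σ.injective (by rw [← e, h1, e]))
      · rw [Finset.mem_insert, not_or]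
        exact ⟨hk, fun hm => hk (σ.injective (hT _ hm))⟩
    · rintro ⟨⟨T, σ⟩, j⟩ hq
      simp only [Finset.mem_filter, Finset.mem_sigma, hΩ, Finset.mem_compl] at hq ⊢
      obtain ⟨⟨hT, hj⟩, hk⟩ := hq
      simp [Finset.insert_erase hk, hT k hk, ← mul_assoc]
    · rintro ⟨T, σ⟩ hp
      simp only [Finset.mem_filter, hΩ] at hp ⊢
      have : k ∉ T := fun e => hp.2 (hp.1 k e)
      simp [this, ← mul_assoc]
    · rintro ⟨⟨T, σ⟩, j⟩ hq
      simp only [Finset.mem_filter, Finset.mem_sigma, hΩ, Finset.mem_compl] at hq ⊢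
      obtain ⟨⟨hT, hj⟩, hk⟩ := hq
      have hjk : k ≠ j := fun e => hj (e ▸ hk)
      have hw : w (swap k j * σ) (T.erase k) = w σ T := by
        simp only [w, map_mul, Perm.sign_swap hjk, ← Finset.card_erase_add_one hk, pow_succ]
        simp
      rw [hw, hX.erase hk]
      simp only [mul_assoc]
  have hB : ∑ p ∈ Ω, (∑ i ∈ p.1, if p.2 k ∉ p.1 then
        w p.2 p.1 • (X p.1 * Y (p.1.erase i) * S (swap i (p.2 k) * p.2)) else 0)
      = ∑ p ∈ Ω, w p.2 p.1 • (if p.2 k ≠ k then x (p.2 k) * (X p.1 * Y p.1 * S p.2) else 0) := by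
    simp only [smul_ite, smul_zero]
    rw [Finset.sum_sigma', ← Finset.sum_filter, ← Finset.sum_filter]
    refine Finset.sum_nbij' (fun q => ⟨q.1.1.erase q.2, swap q.2 (q.1.2 k) * q.1.2⟩)
      (fun p => ⟨⟨insert (p.2 k) p.1, swap (p.2 k) (p.2 (p.2 k)) * p.2⟩, p.2 k⟩) ?_ ?_ ?_ ?_ ?_
    · rintro ⟨⟨T, σ⟩, i⟩ hq
      simp only [Finset.mem_filter, Finset.mem_sigma, hΩ] at hq ⊢
      obtain ⟨⟨hT, hi⟩, hk⟩ := hq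
      refine ⟨fun j hj => ?_, ?_⟩
      · simp only [Finset.mem_erase] at hj
        rw [Perm.mul_apply, hT j hj.2, swap_apply_of_ne_of_ne hj.1 (ne_of_mem_of_not_mem hj.2 hk)]
      · rw [Perm.mul_apply, swap_apply_right]
        rintro rfl
        exact hk (by rwa [hT _ hi])
    · rintro ⟨T, σ⟩ hp
      simp only [Finset.mem_filter, Finset.mem_sigma, hΩ] at hp ⊢
      obtain ⟨hT, hk⟩ := hp
      have hσ : σ (σ k) ≠ σ k := fun e => hk (σ.injective e)
      have hkT : σ k ∉ T := fun e => hσ (hT _ e)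
      refine ⟨⟨fun j hj => ?_, by simp⟩, ?_⟩
      · rcases Finset.mem_insert.1 hj with rfl | hj
        · simp
        · have h1 := hT j hj
          rw [Perm.mul_apply, h1, swap_apply_of_ne_of_ne]
          · rintro rfl; exact hkT hj
          · intro e
            apply hkT
            have : j = σ k := σ.injective (by rw [h1, e])
            rwa [← this]
      · rw [Perm.mul_apply, swap_apply_left, Finset.mem_insert, not_or]
        exact ⟨hσ, fun e => hσ (σ.injective (hT _ e))⟩
    · rintro ⟨⟨T, σ⟩, i⟩ hq
      simp only [Finset.mem_filter, Finset.mem_sigma, hΩ] at hq ⊢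
      obtain ⟨⟨hT, hi⟩, hk⟩ := hq
      simp [Finset.insert_erase hi, hT i hi, ← mul_assoc]
    · rintro ⟨T, σ⟩ hp
      simp only [Finset.mem_filter, hΩ] at hp ⊢
      obtain ⟨hT, hk⟩ := hp
      have : σ k ∉ T := fun e => hk (σ.injective (hT _ e))
      simp [this, ← mul_assoc]
    · rintro ⟨⟨T, σ⟩, i⟩ hq
      simp only [Finset.mem_filter, Finset.mem_sigma, hΩ] at hq ⊢
      obtain ⟨⟨hT, hi⟩, hk⟩ := hq
      have hik : i ≠ σ k := fun e => hk (e ▸ hi)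
      have hw : w (swap i (σ k) * σ) (T.erase i) = w σ T := by
        simp only [w, map_mul, Perm.sign_swap hik, ← Finset.card_erase_add_one hi, pow_succ]
        simp
      rw [hw, hX.erase hi, Perm.mul_apply, swap_apply_right]
      simp only [mul_assoc]
  rw [← sub_eq_zero, hQ, Finset.sum_mul, Finset.mul_sum, ← Finset.sum_sub_distrib,
    Finset.sum_congr rfl hterm, Finset.sum_add_distrib, Finset.sum_sub_distrib, hA, hB,
    ← Finset.sum_sub_distrib, ← Finset.sum_add_distrib]
  refine Finset.sum_eq_zero fun p _ => ?_
  rw [← smul_sub, ← smul_add]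
  by_cases hk : p.2 k = k
  · simp [hk]
  · simp only [hk, ne_eq, not_false_eq_true, if_true, sub_mul, sub_add_sub_cancel, sub_self,
      smul_zero]

theorem op (h : CherednikRel x y S) :
    CherednikRel (fun i => MulOpposite.op (y i)) (fun i => MulOpposite.op (x i))
      (({ toFun := fun σ => MulOpposite.op (S σ⁻¹)
          map_one' := by simp
          map_mul' := fun a b => by simp } : Perm (Fin N) →* Aᵐᵒᵖ)) where
  xx i j := by simp only [← MulOpposite.op_mul, h.yy]
  yy i j := by simp only [← MulOpposite.op_mul, h.xx]
  Sx τ i := by simp [← MulOpposite.op_mul, h.Sy]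
  Sy τ i := by simp [← MulOpposite.op_mul, h.Sx]
  yx_ne i k hik := by
    simp [← MulOpposite.op_mul, h.yx_ne k i hik.symm, swap_comm k i]
  yx_eq k := by simp [← MulOpposite.op_mul, h.yx_eq k]

theorem centralElt_mul_y (h : CherednikRel x y S) (hX : IsFinsetProd x X)
    (hY : IsFinsetProd y Y) (k : Fin N) :
    centralElt X Y S * y k = y k * centralElt X Y S := by
  have hXo : IsFinsetProd (fun i => MulOpposite.op (x i)) (fun T => MulOpposite.op (X T)) :=
    ⟨by simp [hX.empty], fun i T hi => by
      rw [hX.insert i T hi, ← MulOpposite.op_mul, hX.commute fun j _ => h.xx i j]⟩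
  have hYo : IsFinsetProd (fun i => MulOpposite.op (y i)) (fun T => MulOpposite.op (Y T)) :=
    ⟨by simp [hY.empty], fun i T hi => by
      rw [hY.insert i T hi, ← MulOpposite.op_mul, hY.commute fun j _ => h.yy i j]⟩
  have key := h.op.centralElt_mul_x hYo hXo k
  suffices e : centralElt (fun T => MulOpposite.op (Y T)) (fun T => MulOpposite.op (X T))
      (({ toFun := fun σ => MulOpposite.op (S σ⁻¹)
          map_one' := by simp
          map_mul' := fun a b => by simp } : Perm (Fin N) →* Aᵐᵒᵖ))
      = MulOpposite.op (centralElt X Y S) by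
    rw [e, ← MulOpposite.op_mul, ← MulOpposite.op_mul] at key
    exact (MulOpposite.op_injective key).symm
  simp only [centralElt, Finset.op_sum]
  refine Finset.sum_congr rfl fun T _ => ?_
  refine Finset.sum_nbij' (fun σ => σ⁻¹) (fun σ => σ⁻¹) ?_ ?_ ?_ ?_ ?_
  · intro σ hσ
    simp only [Finset.mem_filter, Finset.mem_univ, true_and] at hσ ⊢
    exact fun i hi => by rw [Perm.inv_eq_iff_eq, hσ i hi]
  · intro σ hσ
    simp only [Finset.mem_filter, Finset.mem_univ, true_and] at hσ ⊢
    exact fun i hi => by rw [Perm.inv_eq_iff_eq, hσ i hi]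
  · simp
  · simp
  · intro σ hσ
    simp only [Finset.mem_filter, Finset.mem_univ, true_and] at hσ
    have hσ' : ∀ i ∈ T, σ⁻¹ i = i := fun i hi => by rw [Perm.inv_eq_iff_eq, hσ i hi]
    simp only [MonoidHom.coe_mk, OneHom.coe_mk, ← MulOpposite.op_mul, Perm.sign_inv,
      MulOpposite.op_smul]
    rw [← mul_assoc, hX.perm_commute h.Sx hσ', mul_assoc, hY.perm_commute h.Sy hσ', ← mul_assoc]

theorem centralElt_mul_perm (h : CherednikRel x y S) (hX : IsFinsetProd x X)
    (hY : IsFinsetProd y Y) (τ : Perm (Fin N)) :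
    centralElt X Y S * S τ = S τ * centralElt X Y S := by
  simp only [centralElt, Finset.sum_mul, Finset.mul_sum]
  rw [Finset.sum_sigma', Finset.sum_sigma']
  symm
  refine Finset.sum_nbij' (fun p => ⟨p.1.map τ.toEmbedding, τ * p.2 * τ⁻¹⟩)
    (fun p => ⟨p.1.map (τ⁻¹).toEmbedding, τ⁻¹ * p.2 * τ⟩) ?_ ?_ ?_ ?_ ?_
  · rintro ⟨T, σ⟩ hp
    simp only [Finset.mem_sigma, Finset.mem_univ, Finset.mem_filter, true_and] at hp ⊢
    intro i hi
    obtain ⟨j, hj, rfl⟩ := Finset.mem_map.1 hi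
    simp [hp j hj]
  · rintro ⟨T, σ⟩ hp
    simp only [Finset.mem_sigma, Finset.mem_univ, Finset.mem_filter, true_and] at hp ⊢
    intro i hi
    obtain ⟨j, hj, rfl⟩ := Finset.mem_map.1 hi
    simp [hp j hj]
  · rintro ⟨T, σ⟩ _
    simp [Finset.map_map, mul_assoc]
  · rintro ⟨T, σ⟩ _
    simp [Finset.map_map, mul_assoc]
  · rintro ⟨T, σ⟩ _
    simp only [Finset.card_map, map_mul, Perm.sign_inv, mul_smul_comm, smul_mul_assoc]
    congr 1
    · rcases Int.units_eq_one_or (Perm.sign τ) with e | e <;> simp [e]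
    · rw [← mul_assoc, ← mul_assoc, hX.perm_mul h.Sx, mul_assoc _ _ (Y T), hY.perm_mul h.Sy]
      have : S τ⁻¹ * S τ = 1 := by rw [← map_mul]; simp
      simp only [mul_assoc, this, mul_one]

end CherednikRel

theorem mem_of_forall_sum_pow_smul_mem {V : Type*} [AddCommGroup V] [Module ℂ V]
    (W : Submodule ℂ V) {n : ℕ} (m : Fin n → V)
    (h : ∀ u : ℂ, ∑ i : Fin n, u ^ (i : ℕ) • m i ∈ W) (i : Fin n) : m i ∈ W := by
  rw [← W.ker_mkQ, LinearMap.mem_ker, ← Module.forall_dual_apply_eq_zero_iff ℂ]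
  intro f
  let p : Polynomial ℂ := ∑ i : Fin n, Polynomial.monomial (i : ℕ) (f (W.mkQ (m i)))
  have hp : p = 0 := by
    refine Polynomial.funext fun u => ?_
    have h1 : f (W.mkQ (∑ i : Fin n, u ^ (i : ℕ) • m i)) = 0 := by
      rw [(LinearMap.mem_ker (f := W.mkQ)).1 (by rw [W.ker_mkQ]; exact h u), map_zero]
    simp only [map_sum, map_smul, smul_eq_mul] at h1
    simp only [p, Polynomial.eval_finsetSum, Polynomial.eval_monomial, Polynomial.eval_zero]
    rw [← h1]
    exact Finset.sum_congr rfl fun i _ => mul_comm _ _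
  have := congrArg (fun q => Polynomial.coeff q i) hp
  simpa [p, Polynomial.finsetSum_coeff, Polynomial.coeff_monomial, Fin.val_inj] using this

theorem mem_of_forall_sum_pow_mul_pow_smul_mem {V : Type*} [AddCommGroup V] [Module ℂ V]
    (W : Submodule ℂ V) {n : ℕ} (m : Fin n → Fin n → V)
    (h : ∀ u v : ℂ, ∑ i : Fin n, ∑ j : Fin n, (v ^ (i : ℕ) * u ^ (j : ℕ)) • m i j ∈ W)
    (i j : Fin n) : m i j ∈ W := by
  refine mem_of_forall_sum_pow_smul_mem W (m i) (fun u => ?_) j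
  refine mem_of_forall_sum_pow_smul_mem W (fun i => ∑ j : Fin n, u ^ (j : ℕ) • m i j) (fun v => ?_) i
  simpa only [Finset.smul_sum, smul_smul] using h u v

theorem sum_embedding_prod_mem {R ι : Type*} [CommRing R] [Algebra ℂ R] [Fintype ι]
    (B : Subalgebra ℂ R) (M : Submonoid (ι → R)) (h : ∀ f ∈ M, ∑ j, f j ∈ B) (k : ℕ)
    (f : Fin k → ι → R) (hf : ∀ i, f i ∈ M) :
    ∑ g : Fin k ↪ ι, ∏ i, f i (g i) ∈ B := by
  classical
  induction k with
  | zero => simp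
  | succ k ih =>
    have e1 : ∑ g : Fin (k + 1) ↪ ι, ∏ i, f i (g i)
        = (∑ e : Fin k ↪ ι, ∏ i, f i.succ (e i)) * ∑ j, f 0 j
          - ∑ t, ∑ e : Fin k ↪ ι,
            ∏ i, Function.update (fun i => f i.succ) t (f t.succ * f 0) i (e i) := by
      rw [← (Equiv.embeddingFinSucc k ι).symm.sum_comp, Fintype.sum_sigma, Finset.sum_comm,
        Finset.sum_mul, ← Finset.sum_sub_distrib]
      refine Finset.sum_congr rfl fun e _ => ?_
      have e2 : ∀ t, ∏ i, Function.update (fun i => f i.succ) t (f t.succ * f 0) i (e i)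
          = (∏ i, f i.succ (e i)) * f 0 (e t) := fun t => by
        rw [← Finset.mul_prod_erase _ _ (Finset.mem_univ t),
          ← Finset.mul_prod_erase _ (fun i => f i.succ (e i)) (Finset.mem_univ t),
          Finset.prod_congr rfl fun i hi => by
            rw [Function.update_of_ne (Finset.ne_of_mem_erase hi)]]
        simp only [Function.update_self, Pi.mul_apply]
        ring
      have e3 : ∑ j : {i // i ∉ Set.range e}, f 0 j = ∑ j, f 0 j - ∑ t, f 0 (e t) := by
        rw [eq_sub_iff_add_eq, ← Fintype.sum_subtype_add_sum_subtype (· ∈ Set.range e) (f 0),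
          add_comm]
        congr 1
        convert (Equiv.ofInjective e e.injective).sum_comp fun i : Set.range e => f 0 i
        rfl
      simp only [e2, Equiv.coe_embeddingFinSucc_symm, Fin.prod_univ_succ, Fin.cons_zero,
        Fin.cons_succ]
      rw [← Finset.sum_mul, e3, ← Finset.mul_sum]
      ring
    rw [e1]
    refine sub_mem (mul_mem (ih _ fun i => hf _) (h _ (hf 0))) (sum_mem fun t _ => ih _ fun i => ?_)
    by_cases hi : i = t
    · subst hi
      simpa using mul_mem (hf _) (hf 0)
    · rw [Function.update_of_ne hi]
      exact hf _

theorem sum_sign_fix_eq_zero {α : Type*} [Fintype α] [DecidableEq α] {T : Finset α} {a b : α}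
    (ha : a ∉ T) (hb : b ∉ T) (hab : a ≠ b) :
    ∑ σ : Equiv.Perm α with ∀ i ∈ T, σ i = i, (Equiv.Perm.sign σ : ℤ) = 0 := by
  refine Finset.sum_involution (fun σ _ => Equiv.swap a b * σ) ?_ ?_ ?_ ?_
  · intro σ _; simp [Equiv.Perm.sign_swap hab]
  · intro σ _ _ h
    have := congrArg (fun τ => τ * σ⁻¹) h
    simp only [mul_assoc, mul_inv_cancel, mul_one] at this
    exact hab (Equiv.swap_eq_one_iff.1 this)
  · intro σ hσ
    simp only [Finset.mem_filter, Finset.mem_univ, true_and] at hσ ⊢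
    intro i hi
    rw [Equiv.Perm.mul_apply, hσ i hi, Equiv.swap_apply_of_ne_of_ne (ne_of_mem_of_not_mem hi ha)
      (ne_of_mem_of_not_mem hi hb)]
  · intro σ _; simp [← mul_assoc]

theorem sum_sign_fix_eq_one {α : Type*} [Fintype α] [DecidableEq α] {T : Finset α}
    (hT : Tᶜ.card ≤ 1) :
    ∑ σ : Equiv.Perm α with ∀ i ∈ T, σ i = i, (Equiv.Perm.sign σ : ℤ) = 1 := by
  rw [Finset.sum_eq_single 1]
  · simp
  · intro σ hσ hne
    simp only [Finset.mem_filter, Finset.mem_univ, true_and] at hσ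
    refine absurd (Equiv.ext fun i => ?_) hne
    by_cases hi : i ∈ T
    · simpa using hσ i hi
    · have hσi : σ i ∉ T := fun h => hi (by rwa [σ.injective (hσ _ h)] at h)
      exact Finset.card_le_one.1 hT _ (by simpa using hσi) _ (by simpa using hi)
  · simp

theorem sum_sign_fix_prod {α R : Type*} [Fintype α] [DecidableEq α] [CommRing R] (w : α → R) :
    ∑ T : Finset α, ∑ σ : Equiv.Perm α with ∀ i ∈ T, σ i = i,
      ((Equiv.Perm.sign σ : ℤ) * (-1) ^ T.card) • ∏ i ∈ T, w i
    = (-1) ^ Fintype.card α * (∏ i, w i - ∑ l, ∏ i ∈ Finset.univ.erase l, w i) := by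
  have h1 : ∀ T : Finset α, ∑ σ : Equiv.Perm α with ∀ i ∈ T, σ i = i,
      ((Equiv.Perm.sign σ : ℤ) * (-1) ^ T.card) • ∏ i ∈ T, w i
      = if Tᶜ.card ≤ 1 then (-1) ^ T.card * ∏ i ∈ T, w i else 0 := fun T => by
    rw [← Finset.sum_smul, ← Finset.sum_mul]
    split_ifs with hT
    · rw [sum_sign_fix_eq_one hT]; simp
    · rw [not_le, Finset.one_lt_card] at hT
      obtain ⟨a, ha, b, hb, hab⟩ := hT
      rw [sum_sign_fix_eq_zero (by simpa using ha) (by simpa using hb) hab]; simp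
  rw [Finset.sum_congr rfl fun T _ => h1 T, ← Finset.sum_filter]
  have h2 : (Finset.univ.filter fun T : Finset α => Tᶜ.card ≤ 1)
      = insert Finset.univ (Finset.univ.image fun l => Finset.univ.erase l) := by
    ext T
    simp only [Finset.mem_filter, Finset.mem_univ, true_and, Finset.mem_insert, Finset.mem_image]
    constructor
    · intro h
      rcases Nat.le_one_iff_eq_zero_or_eq_one.1 h with h | h
      · left; simpa using h
      · right
        obtain ⟨l, hl⟩ := Finset.card_eq_one.1 h
        exact ⟨l, by rw [← compl_compl T, hl]; ext; simp⟩
    · rintro (rfl | ⟨l, rfl⟩)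
      · simp
      · have : (Finset.univ.erase l)ᶜ = {l} := by ext; simp
        simp [this]
  rw [h2, Finset.sum_insert, Finset.sum_image, mul_sub, Finset.mul_sum, Finset.card_univ,
    sub_eq_add_neg, ← Finset.sum_neg_distrib]
  · congr 1
    refine Finset.sum_congr rfl fun l _ => ?_
    have : Fintype.card α = (Finset.univ.erase l).card + 1 := by
      rw [Finset.card_erase_add_one (Finset.mem_univ l), Finset.card_univ]
    rw [this, pow_succ]; ring
  · intro a _ b _ hab
    by_contra hne
    have : b ∈ Finset.univ.erase a := by simp [Ne.symm hne]
    rw [show Finset.univ.erase a = Finset.univ.erase b from hab] at this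
    simp at this
  · simp only [Finset.mem_image, Finset.mem_univ, true_and, not_exists]
    intro l hl
    have : l ∈ Finset.univ.erase l := by rw [hl]; simp
    simp at this

/-- The polynomial `∏_{i ∈ T} (t - f i)`. -/
noncomputable def rootProd {R ι : Type*} [CommRing R] (f : ι → R) (T : Finset ι) : Polynomial R :=
  ∏ i ∈ T, (Polynomial.X - Polynomial.C (f i))

section rootProd

open Polynomial

variable {R ι : Type*} [CommRing R] {f : ι → R}

theorem natDegree_rootProd [Nontrivial R] (T : Finset ι) : (rootProd f T).natDegree = T.card := by
  rw [rootProd, natDegree_prod_of_monic _ _ fun _ _ => monic_X_sub_C _]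
  simp

theorem monic_rootProd (T : Finset ι) : (rootProd f T).Monic :=
  monic_prod_of_monic _ _ fun _ _ => monic_X_sub_C _

theorem eval_rootProd (T : Finset ι) (v : R) : (rootProd f T).eval v = ∏ i ∈ T, (v - f i) := by
  simp [rootProd, Polynomial.eval_prod]

theorem eval_rootProd_eq_sum [Nontrivial R] {T : Finset ι} {n : ℕ} (hn : T.card < n) (v : R) :
    ∏ i ∈ T, (v - f i) = ∑ k : Fin n, v ^ (k : ℕ) * (rootProd f T).coeff k := by
  rw [← eval_rootProd, eval_eq_sum_range' (by rwa [natDegree_rootProd]), Finset.sum_range]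
  exact Finset.sum_congr rfl fun i _ => mul_comm _ _

theorem map_coeff_rootProd {S : Type*} [CommRing S] (φ : R →+* S) (T : Finset ι) (n : ℕ) :
    φ ((rootProd f T).coeff n) = (rootProd (fun i => φ (f i)) T).coeff n := by
  rw [← Polynomial.coeff_map, rootProd, Polynomial.map_prod]
  simp [rootProd]

theorem mul_coeff_rootProd_erase_zero [DecidableEq ι] {T : Finset ι} {l : ι} (hl : l ∈ T) :
    f l * (rootProd f (T.erase l)).coeff 0 = -(rootProd f T).coeff 0 := by
  have : rootProd f T = (Polynomial.X - Polynomial.C (f l)) * rootProd f (T.erase l) :=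
    (Finset.mul_prod_erase _ _ hl).symm
  rw [this]
  simp [sub_mul]

theorem mul_coeff_rootProd_erase_succ [DecidableEq ι] {T : Finset ι} {l : ι} (hl : l ∈ T)
    (n : ℕ) : f l * (rootProd f (T.erase l)).coeff (n + 1)
      = (rootProd f (T.erase l)).coeff n - (rootProd f T).coeff (n + 1) := by
  have : rootProd f T = (Polynomial.X - Polynomial.C (f l)) * rootProd f (T.erase l) :=
    (Finset.mul_prod_erase _ _ hl).symm
  rw [this]
  simp [sub_mul]

theorem pow_mem_span_coeff_rootProd_erase [Nontrivial R] [Fintype ι] [DecidableEq ι]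
    (B : Subring R)
    (hB : ∀ n, (rootProd f Finset.univ).coeff n ∈ B) (a : ℕ) :
    (fun l => f l ^ a) ∈ Submodule.span B (Set.range fun n : ℕ => fun l : ι =>
      (rootProd f (Finset.univ.erase l)).coeff n) := by
  set U := Submodule.span B (Set.range fun n : ℕ => fun l : ι =>
      (rootProd f (Finset.univ.erase l)).coeff n) with hU
  have hmem : ∀ n : ℕ, (fun l : ι => (rootProd f (Finset.univ.erase l)).coeff n) ∈ U :=
    fun n => Submodule.subset_span ⟨n, rfl⟩
  have h1 : (fun _ : ι => (1 : R)) ∈ U := by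
    convert hmem (Fintype.card ι - 1) using 2 with l
    have h := (monic_rootProd (f := f) (Finset.univ.erase l)).coeff_natDegree
    rw [natDegree_rootProd, Finset.card_erase_of_mem (Finset.mem_univ l), Finset.card_univ] at h
    exact h.symm
  have hα : ∀ n, (fun _ : ι => (rootProd f Finset.univ).coeff n) ∈ U := fun n => by
    convert U.smul_mem ⟨_, hB n⟩ h1 using 1
    ext l; simp [Subring.smul_def]
  have hmul : ∀ h ∈ U, f * h ∈ U := fun h hh => by
    induction hh using Submodule.span_induction with
    | mem h hh =>
      obtain ⟨n, rfl⟩ := hh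
      cases n with
      | zero =>
        convert U.neg_mem (hα 0) using 1
        ext l
        exact mul_coeff_rootProd_erase_zero (Finset.mem_univ l)
      | succ n =>
        convert U.sub_mem (hmem n) (hα (n + 1)) using 1
        ext l
        exact mul_coeff_rootProd_erase_succ (Finset.mem_univ l) n
    | zero => simp
    | add a b _ _ ha hb => rw [mul_add]; exact U.add_mem ha hb
    | smul c a _ ha => rw [mul_smul_comm]; exact U.smul_mem c ha
  induction a with
  | zero => simpa using h1
  | succ a ih =>
    convert hmul _ ih using 1
    ext l
    simp [pow_succ']

theorem sum_pow_mul_pow_mem [Nontrivial R] [Fintype ι] [DecidableEq ι] {g : ι → R}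
    (B : Subring R)
    (hf : ∀ n, (rootProd f Finset.univ).coeff n ∈ B)
    (hg : ∀ n, (rootProd g Finset.univ).coeff n ∈ B)
    (hfg : ∀ n m, ∑ l, (rootProd f (Finset.univ.erase l)).coeff n *
      (rootProd g (Finset.univ.erase l)).coeff m ∈ B) (a b : ℕ) :
    ∑ l, f l ^ a * g l ^ b ∈ B := by
  suffices key : ∀ p ∈ Submodule.span B (Set.range fun n : ℕ => fun l : ι =>
        (rootProd f (Finset.univ.erase l)).coeff n),
      ∀ q ∈ Submodule.span B (Set.range fun n : ℕ => fun l : ι =>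
        (rootProd g (Finset.univ.erase l)).coeff n), ∑ l, p l * q l ∈ B from
    key _ (pow_mem_span_coeff_rootProd_erase B hf a) _ (pow_mem_span_coeff_rootProd_erase B hg b)
  intro p h q h'
  induction h using Submodule.span_induction with
  | mem p hp =>
    obtain ⟨n, rfl⟩ := hp
    induction h' using Submodule.span_induction with
    | mem q hq => obtain ⟨m, rfl⟩ := hq; exact hfg n m
    | zero => simp
    | add a b _ _ ha hb =>
      simp only [Pi.add_apply, mul_add, Finset.sum_add_distrib]; exact add_mem ha hb
    | smul c a _ ha =>
      simp only [Pi.smul_apply, mul_smul_comm, ← Finset.smul_sum]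
      exact mul_mem c.2 ha
  | zero => simp
  | add a b _ _ ha hb =>
    simp only [Pi.add_apply, add_mul, Finset.sum_add_distrib]; exact add_mem ha hb
  | smul c a _ ha =>
    simp only [Pi.smul_apply, smul_mul_assoc, ← Finset.smul_sum]
    exact mul_mem c.2 ha

theorem isHomogeneous_coeff_rootProd {σ : Type*} (x : ι → σ) (T : Finset ι) :
    ∀ n d, n + d = T.card → ((rootProd (fun i => (MvPolynomial.X (x i) : MvPolynomial σ ℂ))
      T).coeff n).IsHomogeneous d := by
  classical
  induction T using Finset.induction_on with
  | empty =>
    intro n d h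
    obtain ⟨rfl, rfl⟩ : n = 0 ∧ d = 0 := by simpa using h
    simpa [rootProd] using MvPolynomial.isHomogeneous_one σ ℂ
  | insert a T ha ih =>
    intro n d h
    rw [Finset.card_insert_of_notMem ha] at h
    have hd : ∀ n d, n + d = T.card → (MvPolynomial.X (x a) *
        (rootProd (fun i => (MvPolynomial.X (x i) : MvPolynomial σ ℂ)) T).coeff n).IsHomogeneous
        (1 + d) := fun n d h => (MvPolynomial.isHomogeneous_X ℂ _).mul (ih n d h)
    rw [rootProd, Finset.prod_insert ha, ← rootProd, sub_mul, Polynomial.coeff_sub, Polynomial.coeff_C_mul]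
    cases n with
    | zero =>
      rw [Polynomial.coeff_X_mul_zero, zero_sub]
      have := hd 0 T.card (by simp)
      rw [show d = 1 + T.card by omega]
      exact this.neg
    | succ n =>
      rw [Polynomial.coeff_X_mul]
      refine (ih n d (by omega)).sub ?_
      cases d with
      | zero =>
        rw [coeff_eq_zero_of_natDegree_lt, mul_zero]
        · exact MvPolynomial.isHomogeneous_zero _ _ _
        · rw [natDegree_rootProd]; omega
      | succ d =>
        rw [add_comm d 1]
        exact hd _ _ (by omega)

end rootProd

theorem mem_of_perm_invariant {N : ℕ} (B : Subalgebra ℂ (Rzl N))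
    (h : ∀ a b : ℕ, ∑ l, (X (Sum.inr l) : Rzl N) ^ a * X (Sum.inl l) ^ b ∈ B) (f : Rzl N)
    (hf : ∀ σ, permHat N σ f = f) : f ∈ B := by
  have hs : ∀ p : Rzl N, ∑ σ, permHat N σ p ∈ B := by
    intro p
    induction p using MvPolynomial.induction_on' with
    | monomial u a =>
      let M : Submonoid (Fin N → Rzl N) :=
        { carrier := {h | ∃ a b : ℕ, h = fun l => X (Sum.inr l) ^ a * X (Sum.inl l) ^ b}
          one_mem' := ⟨0, 0, by ext1; simp⟩
          mul_mem' := by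
            rintro _ _ ⟨a, b, rfl⟩ ⟨a', b', rfl⟩
            refine ⟨a + a', b + b', ?_⟩
            ext1 l
            simp only [Pi.mul_apply]
            ring }
      have key := sum_embedding_prod_mem B M (by rintro _ ⟨a, b, rfl⟩; exact h a b) N
        (fun i l => X (Sum.inr l) ^ u (Sum.inr i) * X (Sum.inl l) ^ u (Sum.inl i))
        (fun i => ⟨_, _, rfl⟩)
      rw [← (Equiv.embeddingEquivOfFinite (Fin N)).symm.sum_comp] at key
      have e : ∑ σ, permHat N σ (monomial u a) = a • ∑ σ : Equiv.Perm (Fin N), ∏ i,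
          (X (Sum.inr ((Equiv.embeddingEquivOfFinite (Fin N)).symm σ i)) ^ u (Sum.inr i) *
            X (Sum.inl ((Equiv.embeddingEquivOfFinite (Fin N)).symm σ i)) ^ u (Sum.inl i)) := by
        rw [Finset.smul_sum]
        refine Finset.sum_congr rfl fun σ _ => ?_
        rw [monomial_eq, Finsupp.prod_fintype _ _ (by simp), Fintype.prod_sum_type, map_mul,
          map_mul, map_prod, map_prod, mul_comm (∏ i : Fin N, _), ← Finset.prod_mul_distrib,
          ← C_mul']
        simp [permHat, Equiv.embeddingEquivOfFinite]
      rw [e]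
      exact B.smul_mem key a
    | add p q hp hq =>
      simp only [map_add, Finset.sum_add_distrib]
      exact add_mem hp hq
  have h1 := B.smul_mem (hs f) ((Fintype.card (Equiv.Perm (Fin N)) : ℂ)⁻¹)
  simp only [hf, Finset.sum_const, Finset.card_univ] at h1
  rwa [← Nat.cast_smul_eq_nsmul ℂ, inv_smul_smul₀ (by simp [Fintype.card_ne_zero])] at h1

/-- The polynomials all of whose monomials have degree less than `n`. -/
def lowDegree (N n : ℕ) : Submodule ℂ (Rzl N) where
  carrier := {p | ∀ s, n ≤ s.degree → coeff s p = 0}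
  zero_mem' := by simp
  add_mem' := fun {p q} hp hq s hs => by rw [coeff_add, hp s hs, hq s hs, add_zero]
  smul_mem' := fun c p hp s hs => by rw [coeff_smul, hp s hs, smul_zero]

section lowDegree

variable {N n : ℕ}

theorem mem_lowDegree {p : Rzl N} :
    p ∈ lowDegree N n ↔ ∀ s, n ≤ s.degree → coeff s p = 0 := Iff.rfl

theorem mem_lowDegree_iff {p : Rzl N} :
    p ∈ lowDegree N n ↔ p = 0 ∨ p.totalDegree < n := by
  rw [mem_lowDegree]
  constructor
  · intro h
    by_cases hp : p = 0
    · exact Or.inl hp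
    · right
      obtain ⟨s, hs, he⟩ := Finset.exists_mem_eq_sup p.support (by simpa using hp)
        (fun s => s.sum fun _ e => e)
      rw [totalDegree, he]
      by_contra hn
      exact (mem_support_iff.1 hs) (h s (not_lt.1 hn))
  · rintro (rfl | h) s hs
    · simp
    · by_contra hne
      have := le_totalDegree (mem_support_iff.2 hne)
      exact absurd (lt_of_le_of_lt (le_trans hs this) h) (lt_irrefl n)

theorem lowDegree_mono {m : ℕ} (h : m ≤ n) : lowDegree N m ≤ lowDegree N n :=
  fun _ hp s hs => hp s (h.trans hs)

theorem eq_zero_of_mem_lowDegree_zero {p : Rzl N} (h : p ∈ lowDegree N 0) : p = 0 := by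
  ext s; simpa using h s (Nat.zero_le _)

theorem MvPolynomial.IsHomogeneous.mem_lowDegree {p : Rzl N} (h : p.IsHomogeneous n) :
    p ∈ lowDegree N (n + 1) := fun s hs => h.coeff_eq_zero (by omega)

theorem mul_mem_lowDegree {m : ℕ} {p q : Rzl N} (hp : p ∈ lowDegree N n)
    (hq : q ∈ lowDegree N (m + 1)) : p * q ∈ lowDegree N (n + m) := by
  rw [mem_lowDegree_iff] at hp hq ⊢
  rcases hp with rfl | hp
  · simp
  · rcases hq with rfl | hq
    · simp
    · right
      have := totalDegree_mul p q
      omega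

theorem sub_homogeneousComponent_mem_lowDegree {p : Rzl N} (hp : p ∈ lowDegree N (n + 1)) :
    p - homogeneousComponent n p ∈ lowDegree N n := by
  intro s hs
  rw [coeff_sub, coeff_homogeneousComponent]
  split_ifs with h
  · simp
  · rw [hp s (by omega), sub_zero]

theorem of_mul_mem_lowDegree {p q : Rzl N} (hp : p ≠ 0) (h : p * q ∈ lowDegree N n) :
    q ∈ lowDegree N n := by
  rw [mem_lowDegree_iff] at h ⊢
  by_cases hq : q = 0
  · exact Or.inl hq
  · right
    have h' := h.resolve_left (mul_ne_zero hp hq)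
    rw [totalDegree_mul_of_isDomain hp hq] at h'
    omega

theorem rename_mem_lowDegree {p : Rzl N} (f : Fin N ⊕ Fin N → Fin N ⊕ Fin N)
    (hp : p ∈ lowDegree N n) : rename f p ∈ lowDegree N n := by
  rw [mem_lowDegree_iff] at hp ⊢
  rcases hp with rfl | hp
  · simp
  · exact Or.inr (lt_of_le_of_lt (totalDegree_rename_le f p) hp)

end lowDegree

/-- Induction on monomials, multiplying first by the `z_i` and then by the `λ_j`. -/
theorem monomial_induction {N : ℕ} {P : Rzl N → ℕ → Prop} (h1 : P 1 0)
    (hz : ∀ p d i, (∀ j k, sL N j k p = p) → P p d → P (X (Sum.inl i) * p) (d + 1))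
    (hl : ∀ p d j, P p d → P (X (Sum.inr j) * p) (d + 1)) (s : Fin N ⊕ Fin N →₀ ℕ) :
    P (monomial s 1) s.degree := by
  suffices h : ∀ n, ∀ s : Fin N ⊕ Fin N →₀ ℕ, s.degree = n → P (monomial s 1) n ∧
      ((∀ j, s (Sum.inr j) = 0) → ∀ j k, sL N j k (monomial s 1) = monomial s 1) from
    (h _ s rfl).1
  intro n
  induction n with
  | zero =>
    intro s hs
    obtain rfl : s = 0 := (Finsupp.degree_eq_zero_iff s).1 hs
    exact ⟨h1, by simp⟩
  | succ n ih =>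
    intro s hs
    have split : ∀ i, s i ≠ 0 → ∃ t : Fin N ⊕ Fin N →₀ ℕ, t.degree = n ∧
        s = t + Finsupp.single i 1 := fun i hi => by
      have hle : Finsupp.single i 1 ≤ s := by
        rw [Finsupp.single_le_iff]; omega
      refine ⟨s - Finsupp.single i 1, ?_, (tsub_add_cancel_of_le hle).symm⟩
      have := congrArg Finsupp.degree (tsub_add_cancel_of_le hle)
      rw [map_add, Finsupp.degree_single, hs] at this
      omega
    have hmon : ∀ (t : Fin N ⊕ Fin N →₀ ℕ) i,
        monomial (t + Finsupp.single i 1) (1 : ℂ) = X i * monomial t 1 := fun t i => by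
      rw [X, monomial_mul, add_comm, one_mul]
    by_cases hr : ∃ j, s (Sum.inr j) ≠ 0
    · obtain ⟨j, hj⟩ := hr
      obtain ⟨t, ht, rfl⟩ := split _ hj
      refine ⟨?_, fun h => absurd (h j) hj⟩
      rw [hmon]
      exact hl _ _ _ (ih t ht).1
    · push Not at hr
      have : ∃ i, s (Sum.inl i) ≠ 0 := by
        by_contra hcon
        push Not at hcon
        have : s = 0 := by ext (i | i) <;> simp [hcon, hr]
        simp [this] at hs
      obtain ⟨i, hi⟩ := this
      obtain ⟨t, ht, rfl⟩ := split _ hi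
      have htr : ∀ j, t (Sum.inr j) = 0 := fun j => by
        have := hr j
        simpa using this
      have hfix := (ih t ht).2 htr
      rw [hmon]
      refine ⟨hz _ _ _ hfix (ih t ht).1, fun _ j k => ?_⟩
      rw [map_mul, hfix, sL, renameEquiv_apply, rename_X]
      rfl

namespace CherednikRel

open Equiv

variable {N : ℕ} {A : Type*} [Ring A] {x y : Fin N → A} {S : Perm (Fin N) →* A}

/-- The commutator of two `y`'s commutes with the `x`'s as soon as the other relations hold. -/
theorem commutator_comm (hSy : ∀ τ i, S τ * y i = y (τ i) * S τ)
    (hne : ∀ i k, i ≠ k → y i * x k = x k * y i - S (swap i k))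
    (heq : ∀ k, y k * x k = x k * y k + ∑ j ∈ Finset.univ.erase k, S (swap k j)) (i j k : Fin N) :
    (y i * y j - y j * y i) * x k = x k * (y i * y j - y j * y i) := by
  have aux : ∀ i j, i ≠ j →
      (y i * y j - y j * y i) * x i = x i * (y i * y j - y j * y i) := by
    intro i j hij
    have h1 : y i * y j * x i
        = x i * (y i * y j) + (∑ m ∈ Finset.univ.erase i, S (swap i m) * y j)
          - y i * S (swap j i) := by
      rw [mul_assoc, hne j i hij.symm, mul_sub, ← mul_assoc, heq, add_mul, Finset.sum_mul,
        mul_assoc]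
    have h2 : y j * y i * x i = x i * (y j * y i) - S (swap j i) * y i
        + ∑ m ∈ Finset.univ.erase i, y j * S (swap i m) := by
      rw [mul_assoc, heq, mul_add, ← mul_assoc, hne j i hij.symm, sub_mul, Finset.mul_sum,
        mul_assoc]
    have h3 : ∑ m ∈ Finset.univ.erase i, S (swap i m) * y j
        - ∑ m ∈ Finset.univ.erase i, y j * S (swap i m)
        = y i * S (swap i j) - y j * S (swap i j) := by
      rw [← Finset.sum_sub_distrib, Finset.sum_eq_single_of_mem j (by simp [hij.symm])]
      · rw [hSy, swap_apply_right]
      · intro m _ hm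
        rw [hSy, swap_apply_of_ne_of_ne hij.symm hm.symm, sub_self]
    have h4 : S (swap i j) * y i = y j * S (swap i j) := by rw [hSy, swap_apply_left]
    rw [sub_mul, h1, h2, mul_sub, swap_comm j i, h4]
    rw [sub_eq_iff_eq_add] at h3
    rw [h3]
    abel
  by_cases hij : i = j
  · simp [hij]
  by_cases hki : k = i
  · rw [hki]; exact aux i j hij
  by_cases hkj : k = j
  · rw [hkj, ← neg_sub, neg_mul, aux j i (Ne.symm hij), mul_neg]
  have h1 : ∀ i j, i ≠ j → k ≠ i → k ≠ j →
      y i * y j * x k = x k * (y i * y j) - y j * S (swap i k) - y i * S (swap j k) := by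
    intro i j hij hki hkj
    rw [mul_assoc, hne j k hkj.symm, mul_sub, ← mul_assoc, hne i k hki.symm, sub_mul, hSy,
      swap_apply_of_ne_of_ne hij.symm hkj.symm, mul_assoc]
  rw [sub_mul, h1 i j hij hki hkj, h1 j i (Ne.symm hij) hkj hki, mul_sub]
  abel

theorem const_sub [Algebra ℂ A] (h : CherednikRel x y S) (u v : ℂ) :
    CherednikRel (fun i => v • 1 - x i) (fun i => u • 1 - y i) S where
  xx i j := by simp only [sub_mul, mul_sub, h.xx i j, smul_one_mul, mul_smul_one, smul_sub]; abel
  yy i j := by simp only [sub_mul, mul_sub, h.yy i j, smul_one_mul, mul_smul_one, smul_sub]; abel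
  Sx τ i := by simp [sub_mul, mul_sub, h.Sx]
  Sy τ i := by simp [sub_mul, mul_sub, h.Sy]
  yx_ne i k hik := by
    simp only [sub_mul, mul_sub, h.yx_ne i k hik, smul_one_mul, mul_smul_one, smul_sub, smul_comm u v (1 : A)]
    abel
  yx_eq k := by
    simp only [sub_mul, mul_sub, h.yx_eq k, smul_one_mul, mul_smul_one, smul_sub, smul_comm u v (1 : A)]
    abel

end CherednikRel

/-- `K` is the family of operators `K_i = z_i + ∑_{j ≠ i} s_ij^z ∂_ij`. -/
def IsDunkl {N : ℕ} (K : Fin N → Module.End ℂ (Rzl N)) : Prop :=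
  ∃ D : Fin N → Fin N → Rzl N → Rzl N,
    (∀ i j : Fin N, i ≠ j → ∀ p : Rzl N,
      (X (Sum.inr i) - X (Sum.inr j)) * D i j p = p - sL N i j p) ∧
    ∀ (i : Fin N) (p : Rzl N),
      K i p = X (Sum.inl i) * p + ∑ j ∈ Finset.univ.erase i, sZ N i j (D i j p)

/-- The action of the symmetric group by the automorphisms `σ̂`. -/
def permHom (N : ℕ) : Equiv.Perm (Fin N) →* Module.End ℂ (Rzl N) where
  toFun := permOp N
  map_one' := by
    refine LinearMap.ext fun p => ?_
    change rename _ p = p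
    convert rename_id_apply p
    ext (i | i) <;> rfl
  map_mul' σ τ := by
    refine LinearMap.ext fun p => ?_
    simp only [permOp, permHat, AlgEquiv.toLinearMap_apply, Module.End.mul_apply,
      renameEquiv_apply, rename_rename]
    congr 2
    ext (i | i) <;> rfl

theorem permHat_X_inl {N : ℕ} (σ : Equiv.Perm (Fin N)) (i : Fin N) :
    permHat N σ (X (Sum.inl i)) = X (Sum.inl (σ i)) := by simp [permHat]

theorem permHat_X_inr {N : ℕ} (σ : Equiv.Perm (Fin N)) (i : Fin N) :
    permHat N σ (X (Sum.inr i)) = X (Sum.inr (σ i)) := by simp [permHat]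

theorem sZ_sL {N : ℕ} (i j : Fin N) (p : Rzl N) :
    sZ N i j (sL N i j p) = permHat N (Equiv.swap i j) p := by
  simp only [sZ, sL, permHat, renameEquiv_apply, rename_rename]
  congr 2
  ext (i | i) <;> rfl

theorem permHat_sL {N : ℕ} (σ : Equiv.Perm (Fin N)) (i j : Fin N) (p : Rzl N) :
    permHat N σ (sL N i j p) = sL N (σ i) (σ j) (permHat N σ p) := by
  simp only [sL, permHat, renameEquiv_apply, rename_rename]
  congr 2
  ext (k | k)
  · rfl
  · exact congrArg Sum.inr (Equiv.congr_fun (Equiv.mul_swap_eq_swap_mul σ i j) k)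

theorem permHat_sZ {N : ℕ} (σ : Equiv.Perm (Fin N)) (i j : Fin N) (p : Rzl N) :
    permHat N σ (sZ N i j p) = sZ N (σ i) (σ j) (permHat N σ p) := by
  simp only [sZ, permHat, renameEquiv_apply, rename_rename]
  congr 2
  ext (k | k)
  · exact congrArg Sum.inl (Equiv.congr_fun (Equiv.mul_swap_eq_swap_mul σ i j) k)
  · rfl

theorem sZ_X_inr {N : ℕ} (i j k : Fin N) :
    sZ N i j (X (Sum.inr k)) = X (Sum.inr k) := by
  rw [sZ, renameEquiv_apply, rename_X]; rfl

theorem sL_X_inr {N : ℕ} (i j k : Fin N) :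
    sL N i j (X (Sum.inr k)) = X (Sum.inr (Equiv.swap i j k)) := by
  rw [sL, renameEquiv_apply, rename_X]; rfl

theorem sL_X_inl {N : ℕ} (i j k : Fin N) :
    sL N i j (X (Sum.inl k)) = X (Sum.inl k) := by
  rw [sL, renameEquiv_apply, rename_X]; rfl

theorem X_inr_sub_ne_zero {N : ℕ} {i j : Fin N} (hij : i ≠ j) :
    (X (Sum.inr i) - X (Sum.inr j) : Rzl N) ≠ 0 := by
  rw [sub_ne_zero]
  intro h
  exact hij (Sum.inr_injective (X_injective h))

namespace IsDunkl

variable {N : ℕ} {K : Fin N → Module.End ℂ (Rzl N)}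

theorem apply_of_sL (hK : IsDunkl K) {p : Rzl N} (hp : ∀ i j, sL N i j p = p) (i : Fin N) :
    K i p = X (Sum.inl i) * p := by
  obtain ⟨D, hD, hK⟩ := hK
  rw [hK, Finset.sum_eq_zero, add_zero]
  intro j hj
  have h := hD i j (Finset.ne_of_mem_erase hj).symm p
  rw [hp, sub_self, mul_eq_zero] at h
  rw [h.resolve_left (X_inr_sub_ne_zero (Finset.ne_of_mem_erase hj).symm), map_zero]

theorem sub_mem_lowDegree (hK : IsDunkl K) {p : Rzl N} {n : ℕ} (hp : p ∈ lowDegree N n)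
    (i : Fin N) : K i p - X (Sum.inl i) * p ∈ lowDegree N n := by
  obtain ⟨D, hD, hK⟩ := hK
  rw [hK, add_sub_cancel_left]
  refine sum_mem fun j hj => ?_
  have hij := (Finset.ne_of_mem_erase hj).symm
  refine rename_mem_lowDegree _ (of_mul_mem_lowDegree (X_inr_sub_ne_zero hij) ?_)
  rw [hD i j hij]
  exact sub_mem hp (rename_mem_lowDegree _ hp)

theorem apply_mem_lowDegree (hK : IsDunkl K) {p : Rzl N} {n : ℕ} (hp : p ∈ lowDegree N n)
    (i : Fin N) : K i p ∈ lowDegree N (n + 1) := by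
  rw [← sub_add_cancel (K i p) (X (Sum.inl i) * p)]
  refine add_mem (lowDegree_mono (Nat.le_succ n) (hK.sub_mem_lowDegree hp i)) ?_
  rw [mul_comm]
  exact mul_mem_lowDegree hp (isHomogeneous_X ℂ _).mem_lowDegree

theorem permHat_apply (hK : IsDunkl K) (σ : Equiv.Perm (Fin N)) (i : Fin N) (p : Rzl N) :
    permHat N σ (K i p) = K (σ i) (permHat N σ p) := by
  obtain ⟨D, hD, hK⟩ := hK
  rw [hK, hK, map_add, map_mul, permHat_X_inl, map_sum]
  congr 1
  refine Finset.sum_equiv σ (by simp) fun j hj => ?_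
  have hij := (Finset.ne_of_mem_erase hj).symm
  rw [permHat_sZ]
  congr 1
  refine mul_left_cancel₀ (X_inr_sub_ne_zero (σ.injective.ne hij)) ?_
  rw [hD _ _ (σ.injective.ne hij), ← permHat_sL, ← map_sub, ← hD i j hij, map_mul, map_sub,
    permHat_X_inr, permHat_X_inr]

theorem apply_X_mul_of_ne (hK : IsDunkl K) {i k : Fin N} (hik : i ≠ k) (p : Rzl N) :
    K i (X (Sum.inr k) * p) = X (Sum.inr k) * K i p - permHat N (Equiv.swap i k) p := by
  obtain ⟨D, hD, hK⟩ := hK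
  have hk : k ∈ Finset.univ.erase i := by simp [hik.symm]
  have h1 : sZ N i k (D i k (X (Sum.inr k) * p))
      = X (Sum.inr k) * sZ N i k (D i k p) - permHat N (Equiv.swap i k) p := by
    rw [← sZ_sL, ← sZ_X_inr i k k, ← map_mul, ← map_sub, sZ_X_inr]
    congr 1
    refine mul_left_cancel₀ (X_inr_sub_ne_zero hik) ?_
    rw [hD i k hik, map_mul, sL_X_inr, Equiv.swap_apply_right]
    linear_combination -X (Sum.inr k) * hD i k hik p
  have h2 : ∀ j ∈ (Finset.univ.erase i).erase k, sZ N i j (D i j (X (Sum.inr k) * p))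
      = X (Sum.inr k) * sZ N i j (D i j p) := fun j hj => by
    have hjk := Finset.ne_of_mem_erase hj
    have hij := (Finset.ne_of_mem_erase (Finset.mem_of_mem_erase hj)).symm
    rw [← sZ_X_inr i j k, ← map_mul, sZ_X_inr]
    congr 1
    refine mul_left_cancel₀ (X_inr_sub_ne_zero hij) ?_
    rw [hD i j hij, map_mul, sL_X_inr, Equiv.swap_apply_of_ne_of_ne hik.symm hjk.symm]
    linear_combination -X (Sum.inr k) * hD i j hij p
  rw [hK, hK, ← Finset.add_sum_erase _ _ hk, ← Finset.add_sum_erase _ _ hk, h1,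
    Finset.sum_congr rfl h2, ← Finset.mul_sum]
  ring

theorem apply_X_mul_self (hK : IsDunkl K) (i : Fin N) (p : Rzl N) :
    K i (X (Sum.inr i) * p)
      = X (Sum.inr i) * K i p + ∑ j ∈ Finset.univ.erase i, permHat N (Equiv.swap i j) p := by
  obtain ⟨D, hD, hK⟩ := hK
  have h2 : ∀ j ∈ Finset.univ.erase i, sZ N i j (D i j (X (Sum.inr i) * p))
      = X (Sum.inr i) * sZ N i j (D i j p) + permHat N (Equiv.swap i j) p := fun j hj => by
    have hij := (Finset.ne_of_mem_erase hj).symm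
    rw [← sZ_sL, ← sZ_X_inr i j i, ← map_mul, ← map_add, sZ_X_inr]
    congr 1
    refine mul_left_cancel₀ (X_inr_sub_ne_zero hij) ?_
    rw [hD i j hij, map_mul, sL_X_inr, Equiv.swap_apply_left]
    linear_combination -X (Sum.inr i) * hD i j hij p
  rw [hK, hK, Finset.sum_congr rfl h2, Finset.sum_add_distrib, ← Finset.mul_sum]
  ring

theorem cherednikRel (hK : IsDunkl K) :
    CherednikRel (fun i => mulP N (X (Sum.inr i))) K (permHom N) := by
  have hSy : ∀ τ i, permHom N τ * K i = K (τ i) * permHom N τ := fun τ i =>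
    LinearMap.ext fun p => hK.permHat_apply τ i p
  have hne : ∀ i k, i ≠ k → K i * mulP N (X (Sum.inr k))
      = mulP N (X (Sum.inr k)) * K i - permHom N (Equiv.swap i k) := fun i k hik =>
    LinearMap.ext fun p => hK.apply_X_mul_of_ne hik p
  have heq : ∀ k, K k * mulP N (X (Sum.inr k)) = mulP N (X (Sum.inr k)) * K k
      + ∑ j ∈ Finset.univ.erase k, permHom N (Equiv.swap k j) := fun k =>
    LinearMap.ext fun p => by
      rw [LinearMap.add_apply, LinearMap.sum_apply]
      exact hK.apply_X_mul_self k p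
  refine ⟨fun i j => LinearMap.ext fun p => mul_left_comm _ _ _, fun i j => ?_,
    fun τ i => LinearMap.ext fun p => ?_, hSy, hne, heq⟩
  · rw [← sub_eq_zero]
    refine (basisMonomials _ ℂ).ext fun s => ?_
    rw [coe_basisMonomials, LinearMap.zero_apply]
    refine monomial_induction (P := fun p _ => (K i * K j - K j * K i) p = 0) ?_ ?_ ?_ s
    · have h1 : ∀ i j, sL N i j (1 : Rzl N) = 1 := fun i j => map_one _
      have hX : ∀ k i j, sL N i j (X (Sum.inl k) * 1) = X (Sum.inl k) * 1 := fun k i j => by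
        rw [map_mul, h1, sL_X_inl]
      rw [LinearMap.sub_apply, Module.End.mul_apply, Module.End.mul_apply, hK.apply_of_sL h1,
        hK.apply_of_sL h1, hK.apply_of_sL (hX i), hK.apply_of_sL (hX j)]
      ring
    · intro p _ k hp _
      have hX : ∀ k p, (∀ i j, sL N i j p = p) → ∀ i j, sL N i j (X (Sum.inl k) * p)
          = X (Sum.inl k) * p := fun k p hp i j => by
        rw [map_mul, hp, sL_X_inl]
      have hp' := hX k p hp
      rw [LinearMap.sub_apply, Module.End.mul_apply, Module.End.mul_apply, hK.apply_of_sL hp',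
        hK.apply_of_sL hp', hK.apply_of_sL (hX i _ hp'), hK.apply_of_sL (hX j _ hp')]
      ring
    · intro p _ k hp
      have h := LinearMap.congr_fun (CherednikRel.commutator_comm hSy hne heq i j k) p
      refine (h : (K i * K j - K j * K i) (X (Sum.inr k) * p) = _).trans ?_
      rw [Module.End.mul_apply, hp, map_zero]
  · change permHat N τ (X (Sum.inr i) * p) = X (Sum.inr (τ i)) * permHat N τ p
    rw [map_mul, permHat_X_inr]

/-- An operator commuting with the `λ_j` and the `K_i` whose value at `1` does not involve the
`λ_j` (or is symmetric in them) is multiplication by that value. -/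
theorem apply_eq_mul (hK : IsDunkl K) {a : Module.End ℂ (Rzl N)}
    (hx : ∀ i, a * mulP N (X (Sum.inr i)) = mulP N (X (Sum.inr i)) * a)
    (hy : ∀ i, a * K i = K i * a) (ha : ∀ i j, sL N i j (a 1) = a 1) (p : Rzl N) :
    a p = a 1 * p := by
  suffices h : a = LinearMap.mulLeft ℂ (a 1) from LinearMap.congr_fun h p
  refine (basisMonomials _ ℂ).ext fun s => ?_
  rw [coe_basisMonomials, LinearMap.mulLeft_apply]
  refine monomial_induction (P := fun p _ => a p = a 1 * p) (by simp) ?_ ?_ s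
  · intro p _ i hp h
    have h1 : a (K i p) = K i (a p) := LinearMap.congr_fun (hy i) p
    rw [hK.apply_of_sL hp, h, hK.apply_of_sL fun j k => by rw [map_mul, ha, hp]] at h1
    rw [h1, mul_left_comm]
  · intro p _ j h
    have h1 : a (X (Sum.inr j) * p) = X (Sum.inr j) * a p := LinearMap.congr_fun (hx j) p
    rw [h1, h, mul_left_comm]

/-- An operator commuting with the `λ_j` and the `K_i` is, up to terms of lower degree,
multiplication by its value at `1`. -/
theorem apply_sub_mul_mem_lowDegree (hK : IsDunkl K) {a : Module.End ℂ (Rzl N)}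
    (hx : ∀ i, a * mulP N (X (Sum.inr i)) = mulP N (X (Sum.inr i)) * a)
    (hy : ∀ i, a * K i = K i * a) {n k : ℕ} (ha : a 1 ∈ lowDegree N (n + 1)) {p : Rzl N}
    (hp : p ∈ lowDegree N (k + 1)) : a p - a 1 * p ∈ lowDegree N (n + k) := by
  have hmon : ∀ s, (monomial s (1 : ℂ) : Rzl N) ∈ lowDegree N (s.degree + 1) ∧
      a (monomial s 1) - a 1 * monomial s 1 ∈ lowDegree N (n + s.degree) := by
    intro s
    refine monomial_induction (P := fun p d => p ∈ lowDegree N (d + 1) ∧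
      a p - a 1 * p ∈ lowDegree N (n + d)) ?_ ?_ ?_ s
    · refine ⟨(isHomogeneous_one _ ℂ).mem_lowDegree, by simp⟩
    · rintro p d i hp ⟨hpd, h⟩
      refine ⟨?_, ?_⟩
      · rw [mul_comm]
        exact mul_mem_lowDegree hpd (isHomogeneous_X ℂ _).mem_lowDegree
      have h1 : a (K i p) = K i (a p) := LinearMap.congr_fun (hy i) p
      rw [hK.apply_of_sL hp] at h1
      have h2 : a (X (Sum.inl i) * p) - a 1 * (X (Sum.inl i) * p)
          = K i (a p - a 1 * p) + (K i (a 1 * p) - X (Sum.inl i) * (a 1 * p)) := by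
        rw [h1, map_sub]; ring
      rw [h2]
      refine add_mem (hK.apply_mem_lowDegree h i) (hK.sub_mem_lowDegree ?_ i)
      have := mul_mem_lowDegree ha hpd
      rwa [show n + (d + 1) = n + 1 + d by ring]
    · rintro p d j ⟨hpd, h⟩
      have h1 : a (X (Sum.inr j) * p) = X (Sum.inr j) * a p := LinearMap.congr_fun (hx j) p
      have h2 : a (X (Sum.inr j) * p) - a 1 * (X (Sum.inr j) * p)
          = (a p - a 1 * p) * X (Sum.inr j) := by
        rw [h1]; ring
      refine ⟨?_, ?_⟩
      · rw [mul_comm]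
        exact mul_mem_lowDegree hpd (isHomogeneous_X ℂ _).mem_lowDegree
      · rw [h2]
        exact mul_mem_lowDegree (n := n + d) (m := 1) h (isHomogeneous_X ℂ _).mem_lowDegree
  have h : a p - a 1 * p = ∑ s ∈ p.support,
      coeff s p • (a (monomial s 1) - a 1 * monomial s 1) := by
    conv_lhs => rw [p.as_sum]
    rw [map_sum, Finset.mul_sum, ← Finset.sum_sub_distrib]
    refine Finset.sum_congr rfl fun s _ => ?_
    rw [← mul_one (coeff s p), ← smul_eq_mul, ← smul_monomial, map_smul, mul_smul_comm, smul_sub]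
    simp
  rw [h]
  refine sum_mem fun s hs => Submodule.smul_mem _ _ (lowDegree_mono ?_ (hmon s).2)
  by_contra hcon
  exact mem_support_iff.1 hs (hp s (by omega))

end IsDunkl

theorem isFinsetProd_ordProd {N : ℕ} {f : Fin N → Module.End ℂ (Rzl N)}
    (hf : ∀ i j, f i * f j = f j * f i) : IsFinsetProd f fun T => ordProd T f where
  empty := by simp [ordProd]
  insert i T hi := by
    have hp : ((insert i T).sort (· ≤ ·)).Perm (i :: T.sort (· ≤ ·)) := by
      rw [← Multiset.coe_eq_coe, Finset.sort_eq, ← Multiset.cons_coe, Finset.sort_eq,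
        Finset.insert_val_of_notMem hi]
    have hc : (((insert i T).sort (· ≤ ·)).map f).Pairwise Commute :=
      List.pairwise_map.2 (List.pairwise_of_forall fun a b => hf a b)
    rw [ordProd, (hp.map f).prod_eq' hc, List.map_cons, List.prod_cons, ordProd]

theorem isFinsetProd_mulP (N : ℕ) (v : ℂ) :
    IsFinsetProd (fun i => v • (1 : Module.End ℂ (Rzl N)) - mulP N (X (Sum.inr i)))
      fun T => mulP N (∏ i ∈ T, (C v - X (Sum.inr i))) where
  empty := LinearMap.ext fun p => by simp [mulP]
  insert i T hi := LinearMap.ext fun p => by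
    simp [mulP, Finset.prod_insert hi, sub_mul, mul_assoc, ← C_mul']

theorem Puv_eq_centralElt {N : ℕ} (K : Fin N → Module.End ℂ (Rzl N)) (u v : ℂ) :
    Puv K u v = ((-1 : ℤ) ^ N) • centralElt (fun T => mulP N (∏ i ∈ T, (C v - X (Sum.inr i))))
      (fun T => ordProd T fun i => u • 1 - K i) (permHom N) := by
  rw [Puv, centralElt]
  congr 1
  simp only [Finset.sum_mul, Finset.smul_sum, smul_mul_assoc, smul_smul]
  refine Finset.sum_comm' fun σ T => ?_
  simp [Finset.subset_iff]

theorem commute_of_commute_smul_one_sub {A : Type*} [Ring A] [Algebra ℂ A] {a b : A} {u : ℂ}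
    (h : a * (u • 1 - b) = (u • 1 - b) * a) : a * b = b * a := by
  rw [mul_sub, sub_mul, mul_smul_one, smul_one_mul] at h
  exact sub_right_injective h

namespace IsDunkl

variable {N : ℕ} {K : Fin N → Module.End ℂ (Rzl N)}

theorem Puv_mul_mulP (hK : IsDunkl K) (u v : ℂ) (k : Fin N) :
    Puv K u v * mulP N (X (Sum.inr k)) = mulP N (X (Sum.inr k)) * Puv K u v := by
  have h := hK.cherednikRel.const_sub u v
  refine commute_of_commute_smul_one_sub (u := v) ?_
  rw [Puv_eq_centralElt, smul_mul_assoc, mul_smul_comm,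
    h.centralElt_mul_x (isFinsetProd_mulP N v) (isFinsetProd_ordProd h.yy)]

theorem Puv_mul_K (hK : IsDunkl K) (u v : ℂ) (k : Fin N) :
    Puv K u v * K k = K k * Puv K u v := by
  have h := hK.cherednikRel.const_sub u v
  refine commute_of_commute_smul_one_sub (u := u) ?_
  rw [Puv_eq_centralElt, smul_mul_assoc, mul_smul_comm,
    h.centralElt_mul_y (isFinsetProd_mulP N v) (isFinsetProd_ordProd h.yy)]

theorem Puv_mul_permOp (hK : IsDunkl K) (u v : ℂ) (σ : Equiv.Perm (Fin N)) :
    Puv K u v * permOp N σ = permOp N σ * Puv K u v := by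
  have h := hK.cherednikRel.const_sub u v
  change _ * permHom N σ = permHom N σ * _
  rw [Puv_eq_centralElt, smul_mul_assoc, mul_smul_comm,
    h.centralElt_mul_perm (isFinsetProd_mulP N v) (isFinsetProd_ordProd h.yy)]

theorem ordProd_apply_one (hK : IsDunkl K) (u : ℂ) (T : Finset (Fin N)) :
    ordProd T (fun i => u • (1 : Module.End ℂ (Rzl N)) - K i) 1
      = ∏ i ∈ T, (C u - X (Sum.inl i)) := by
  have h := isFinsetProd_ordProd (hK.cherednikRel.const_sub u 0).yy
  induction T using Finset.induction_on with
  | empty => rw [h.empty, Finset.prod_empty, Module.End.one_apply]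
  | insert i T hi ih =>
    rw [h.insert i T hi, Module.End.mul_apply, ih, Finset.prod_insert hi, LinearMap.sub_apply,
      hK.apply_of_sL fun j k => ?_, LinearMap.smul_apply, Module.End.one_apply, sub_mul, C_mul']
    rw [map_prod]
    refine Finset.prod_congr rfl fun l _ => ?_
    rw [map_sub, sL_X_inl, ← algebraMap_eq, AlgEquiv.commutes]

theorem Puv_apply_one (hK : IsDunkl K) (u v : ℂ) :
    Puv K u v 1 = ∏ i : Fin N, ((C v - X (Sum.inr i)) * (C u - X (Sum.inl i)))
      - ∑ l : Fin N, ∏ i ∈ Finset.univ.erase l,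
        ((C v - X (Sum.inr i)) * (C u - X (Sum.inl i))) := by
  have h := sum_sign_fix_prod fun i : Fin N =>
    ((C v - X (Sum.inr i)) * (C u - X (Sum.inl i)) : Rzl N)
  rw [Fintype.card_fin] at h
  have h1 : ∀ (T : Finset (Fin N)) (σ : Equiv.Perm (Fin N)),
      (mulP N (∏ i ∈ T, (C v - X (Sum.inr i))) * ordProd T (fun i => u • 1 - K i)
        * permHom N σ) 1 = ∏ i ∈ T, ((C v - X (Sum.inr i)) * (C u - X (Sum.inl i))) :=
    fun T σ => by
      have hσ : permHom N σ 1 = 1 := map_one (permHat N σ)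
      rw [Module.End.mul_apply, hσ, Module.End.mul_apply, hK.ordProd_apply_one,
        Finset.prod_mul_distrib]
      rfl
  rw [Puv_eq_centralElt, centralElt, LinearMap.smul_apply, LinearMap.sum_apply]
  simp only [LinearMap.sum_apply, LinearMap.smul_apply, h1]
  refine Eq.trans (congrArg _ (Eq.trans ?_ h)) ?_
  · congr!
  · rw [zsmul_eq_mul, ← mul_assoc]
    push_cast
    rw [← mul_pow, neg_one_mul, neg_neg, one_pow, one_mul]

end IsDunkl

theorem Puv_mem_cherednik {N : ℕ} (K : Fin N → Module.End ℂ (Rzl N)) (u v : ℂ) :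
    Puv K u v ∈ cherednik N K := by
  have hx : ∀ i, mulP N (X (Sum.inr i)) ∈ cherednik N K := fun i =>
    Algebra.subset_adjoin (Or.inl (Or.inl ⟨i, rfl⟩))
  have hy : ∀ i, K i ∈ cherednik N K := fun i => Algebra.subset_adjoin (Or.inl (Or.inr ⟨i, rfl⟩))
  have hs : ∀ σ, permOp N σ ∈ cherednik N K := fun σ => Algebra.subset_adjoin (Or.inr ⟨σ, rfl⟩)
  refine zsmul_mem (sum_mem fun σ _ => zsmul_mem (mul_mem (sum_mem fun T _ =>
    zsmul_mem (mul_mem ?_ ?_) _) (hs σ)) _) _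
  · have h := isFinsetProd_mulP N v
    clear * - h hx
    induction T using Finset.induction_on with
    | empty => rw [h.empty]; exact one_mem _
    | insert i T hi ih =>
      rw [h.insert i T hi]
      exact mul_mem (sub_mem (Subalgebra.smul_mem _ (one_mem _) v) (hx i)) ih
  · refine list_prod_mem fun a ha => ?_
    obtain ⟨i, _, rfl⟩ := List.mem_map.1 ha
    exact sub_mem (Subalgebra.smul_mem _ (one_mem _) u) (hy i)

/-- The coefficients of `∏_{i ∈ T} (t - z_i)`. -/
def zCoeff (N : ℕ) (T : Finset (Fin N)) (n : ℕ) : Rzl N :=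
  (rootProd (fun i => (X (Sum.inl i) : Rzl N)) T).coeff n

/-- The coefficients of `∏_{i ∈ T} (t - λ_i)`. -/
def lCoeff (N : ℕ) (T : Finset (Fin N)) (n : ℕ) : Rzl N :=
  (rootProd (fun i => (X (Sum.inr i) : Rzl N)) T).coeff n

/-- `m` is the family of coefficients of `P(u,v)` with respect to the monomials `v^i u^j`. -/
def IsPuvCoeff {N : ℕ} (K : Fin N → Module.End ℂ (Rzl N))
    (m : Fin (N + 1) → Fin (N + 1) → Module.End ℂ (Rzl N)) : Prop :=
  ∀ u v : ℂ, Puv K u v = ∑ i : Fin (N + 1), ∑ j : Fin (N + 1), (v ^ (i : ℕ) * u ^ (j : ℕ)) • m i j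

section coefficients

variable {N : ℕ} {T : Finset (Fin N)} {n d : ℕ}

theorem zCoeff_eq_zero (h : T.card < n) : zCoeff N T n = 0 :=
  Polynomial.coeff_eq_zero_of_natDegree_lt (by rwa [natDegree_rootProd])

theorem lCoeff_eq_zero (h : T.card < n) : lCoeff N T n = 0 :=
  Polynomial.coeff_eq_zero_of_natDegree_lt (by rwa [natDegree_rootProd])

theorem zCoeff_card (T : Finset (Fin N)) : zCoeff N T T.card = 1 := by
  have := (monic_rootProd (f := fun i => (X (Sum.inl i) : Rzl N)) T).coeff_natDegree
  rwa [natDegree_rootProd] at this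

theorem lCoeff_card (T : Finset (Fin N)) : lCoeff N T T.card = 1 := by
  have := (monic_rootProd (f := fun i => (X (Sum.inr i) : Rzl N)) T).coeff_natDegree
  rwa [natDegree_rootProd] at this

theorem zCoeff_isHomogeneous (h : n + d = T.card) : (zCoeff N T n).IsHomogeneous d :=
  isHomogeneous_coeff_rootProd Sum.inl T n d h

theorem lCoeff_isHomogeneous (h : n + d = T.card) : (lCoeff N T n).IsHomogeneous d :=
  isHomogeneous_coeff_rootProd Sum.inr T n d h

theorem prod_C_sub_X_inl (h : T.card < n) (u : ℂ) :
    ∏ i ∈ T, (C u - X (Sum.inl i) : Rzl N) = ∑ k : Fin n, u ^ (k : ℕ) • zCoeff N T k := by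
  rw [eval_rootProd_eq_sum h]
  simp [smul_eq_C_mul, zCoeff]

theorem prod_C_sub_X_inr (h : T.card < n) (u : ℂ) :
    ∏ i ∈ T, (C u - X (Sum.inr i) : Rzl N) = ∑ k : Fin n, u ^ (k : ℕ) • lCoeff N T k := by
  rw [eval_rootProd_eq_sum h]
  simp [smul_eq_C_mul, lCoeff]

theorem sL_zCoeff (i j : Fin N) : sL N i j (zCoeff N T n) = zCoeff N T n := by
  refine (map_coeff_rootProd (sL N i j).toRingEquiv.toRingHom T n).trans ?_
  have : (fun k => (sL N i j).toRingEquiv.toRingHom (X (Sum.inl k)))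
      = fun k => (X (Sum.inl k) : Rzl N) := funext fun k => sL_X_inl i j k
  rw [zCoeff, ← this]

end coefficients

namespace IsPuvCoeff

variable {N : ℕ} {K : Fin N → Module.End ℂ (Rzl N)}
  {m : Fin (N + 1) → Fin (N + 1) → Module.End ℂ (Rzl N)}

theorem mem_cherednik (hm : IsPuvCoeff K m) (i j : Fin (N + 1)) : m i j ∈ cherednik N K :=
  mem_of_forall_sum_pow_mul_pow_smul_mem (Subalgebra.toSubmodule (cherednik N K)) m
    (fun u v => by rw [← hm u v]; exact Puv_mem_cherednik K u v) i j

theorem mul_comm_of_Puv (hm : IsPuvCoeff K m) {b : Module.End ℂ (Rzl N)}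
    (hb : ∀ u v, Puv K u v * b = b * Puv K u v) (i j : Fin (N + 1)) : m i j * b = b * m i j := by
  have h : m i j ∈ Subalgebra.toSubmodule (Subalgebra.centralizer ℂ {b}) :=
    mem_of_forall_sum_pow_mul_pow_smul_mem _ m (fun u v => by
      rw [← hm u v, Subalgebra.mem_toSubmodule, Subalgebra.mem_centralizer_iff]
      rintro _ rfl
      exact (hb u v).symm) i j
  rw [Subalgebra.mem_toSubmodule, Subalgebra.mem_centralizer_iff] at h
  exact (h b rfl).symm

theorem apply_one (hK : IsDunkl K) (hm : IsPuvCoeff K m) (i j : Fin (N + 1)) :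
    m i j 1 = lCoeff N Finset.univ i * zCoeff N Finset.univ j
      - ∑ l, lCoeff N (Finset.univ.erase l) i * zCoeff N (Finset.univ.erase l) j := by
  rw [← sub_eq_zero, ← Submodule.mem_bot ℂ]
  refine mem_of_forall_sum_pow_mul_pow_smul_mem ⊥ (fun i j : Fin (N + 1) => m i j 1 -
    (lCoeff N Finset.univ i * zCoeff N Finset.univ j
      - ∑ l, lCoeff N (Finset.univ.erase l) i * zCoeff N (Finset.univ.erase l) j))
    (fun u v => ?_) i j
  have h1 := LinearMap.congr_fun (hm u v) 1
  have hT : ∀ T : Finset (Fin N), T.card < N + 1 := fun T =>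
    Nat.lt_succ_of_le (by simpa using T.card_le_univ)
  have hp : ∀ T : Finset (Fin N), ∏ i ∈ T, ((C v - X (Sum.inr i)) * (C u - X (Sum.inl i)) : Rzl N)
      = ∑ i : Fin (N + 1), ∑ j : Fin (N + 1),
        (v ^ (i : ℕ) * u ^ (j : ℕ)) • (lCoeff N T i * zCoeff N T j) := fun T => by
    rw [Finset.prod_mul_distrib, prod_C_sub_X_inl (hT T), prod_C_sub_X_inr (hT T),
      Finset.sum_mul_sum]
    simp only [smul_mul_smul_comm]
  rw [hK.Puv_apply_one, hp] at h1
  simp only [hp, LinearMap.sum_apply, LinearMap.smul_apply] at h1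
  rw [Submodule.mem_bot]
  simp only [smul_sub, Finset.sum_sub_distrib, ← h1, Finset.smul_sum]
  rw [sub_eq_zero]
  congr 1
  rw [Finset.sum_comm]
  exact Finset.sum_congr rfl fun i _ => Finset.sum_comm

end IsPuvCoeff

theorem mul_eq_mul_of_mem_centralizer {N : ℕ} {K : Fin N → Module.End ℂ (Rzl N)}
    {a : Module.End ℂ (Rzl N)} (ha : a ∈ Subalgebra.centralizer ℂ (cherednik N K : Set _)) :
    (∀ i, a * mulP N (X (Sum.inr i)) = mulP N (X (Sum.inr i)) * a) ∧
      (∀ i, a * K i = K i * a) ∧ ∀ σ, a * permOp N σ = permOp N σ * a := by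
  rw [Subalgebra.mem_centralizer_iff] at ha
  exact ⟨fun i => (ha _ (Algebra.subset_adjoin (Or.inl (Or.inl ⟨i, rfl⟩)))).symm,
    fun i => (ha _ (Algebra.subset_adjoin (Or.inl (Or.inr ⟨i, rfl⟩)))).symm,
    fun σ => (ha _ (Algebra.subset_adjoin (Or.inr ⟨σ, rfl⟩))).symm⟩

theorem permHat_apply_one_of_mem_centralizer {N : ℕ} {K : Fin N → Module.End ℂ (Rzl N)}
    {a : Module.End ℂ (Rzl N)} (ha : a ∈ Subalgebra.centralizer ℂ (cherednik N K : Set _))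
    (σ : Equiv.Perm (Fin N)) : permHat N σ (a 1) = a 1 := by
  have h : a (permHat N σ 1) = permHat N σ (a 1) :=
    LinearMap.congr_fun ((mul_eq_mul_of_mem_centralizer ha).2.2 σ) 1
  rw [← h, map_one]

/-- The leading terms of the polynomials `a 1`, where `a` runs through an algebra `A` of operators
commuting with the Cherednik algebra. -/
def leadingTerms {N : ℕ} {K : Fin N → Module.End ℂ (Rzl N)} (hK : IsDunkl K)
    (A : Subalgebra ℂ (Module.End ℂ (Rzl N)))
    (hA : A ≤ Subalgebra.centralizer ℂ (cherednik N K : Set _)) : Submonoid (Rzl N) where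
  carrier := {f | ∃ d, f.IsHomogeneous d ∧ ∃ a ∈ A, a 1 - f ∈ lowDegree N d}
  one_mem' := ⟨0, isHomogeneous_one _ _, 1, one_mem A, by simp⟩
  mul_mem' := by
    rintro f g ⟨d, hf, a, ha, haf⟩ ⟨e, hg, b, hb, hbg⟩
    refine ⟨d + e, hf.mul hg, a * b, mul_mem ha hb, ?_⟩
    have ha1 : a 1 ∈ lowDegree N (d + 1) := by
      rw [← sub_add_cancel (a 1) f]
      exact add_mem (lowDegree_mono (Nat.le_succ d) haf) hf.mem_lowDegree
    have hb1 : b 1 ∈ lowDegree N (e + 1) := by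
      rw [← sub_add_cancel (b 1) g]
      exact add_mem (lowDegree_mono (Nat.le_succ e) hbg) hg.mem_lowDegree
    obtain ⟨hx, hy, -⟩ := mul_eq_mul_of_mem_centralizer (hA ha)
    have h : (a * b) 1 - f * g = (a (b 1) - a 1 * b 1) + (a 1 - f) * b 1 + (b 1 - g) * f := by
      rw [Module.End.mul_apply]; ring
    rw [h]
    refine add_mem (add_mem (hK.apply_sub_mul_mem_lowDegree hx hy ha1 hb1)
      (mul_mem_lowDegree haf hb1)) ?_
    rw [add_comm d e]
    exact mul_mem_lowDegree hbg hf.mem_lowDegree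

section leadingTerms

variable {N : ℕ} {K : Fin N → Module.End ℂ (Rzl N)} {hK : IsDunkl K}
  {A : Subalgebra ℂ (Module.End ℂ (Rzl N))}
  {hA : A ≤ Subalgebra.centralizer ℂ (cherednik N K : Set _)}

theorem exists_sub_homogeneousComponent_mem_lowDegree {f : Rzl N}
    (hf : f ∈ Algebra.adjoin ℂ (leadingTerms hK A hA : Set (Rzl N))) (d : ℕ) :
    ∃ a ∈ A, a 1 - homogeneousComponent d f ∈ lowDegree N d := by
  rw [← Subalgebra.mem_toSubmodule, Algebra.adjoin_eq_span, Submonoid.closure_eq] at hf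
  induction hf using Submodule.span_induction with
  | mem f hf =>
    obtain ⟨e, he, a, ha, haf⟩ := hf
    rw [homogeneousComponent_of_mem he]
    split_ifs with hde
    · exact ⟨a, ha, hde ▸ haf⟩
    · exact ⟨0, zero_mem A, by simp⟩
  | zero => exact ⟨0, zero_mem A, by simp⟩
  | add f g _ _ hf hg =>
    obtain ⟨a, ha, haf⟩ := hf
    obtain ⟨b, hb, hbg⟩ := hg
    refine ⟨a + b, add_mem ha hb, ?_⟩
    rw [map_add, LinearMap.add_apply, add_sub_add_comm]
    exact add_mem haf hbg
  | smul r f _ hf =>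
    obtain ⟨a, ha, haf⟩ := hf
    refine ⟨r • a, A.smul_mem ha r, ?_⟩
    rw [map_smul, LinearMap.smul_apply, ← smul_sub]
    exact Submodule.smul_mem _ r haf

theorem exists_apply_one_eq
    (h : ∀ f, (∀ σ, permHat N σ f = f) →
      f ∈ Algebra.adjoin ℂ (leadingTerms hK A hA : Set (Rzl N)))
    {f : Rzl N} (hf : ∀ σ, permHat N σ f = f) : ∃ a ∈ A, a 1 = f := by
  suffices key : ∀ d, ∀ f ∈ lowDegree N d, (∀ σ, permHat N σ f = f) → ∃ a ∈ A, a 1 = f from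
    key (f.totalDegree + 1) f (mem_lowDegree_iff.2 (Or.inr (Nat.lt_succ_self _))) hf
  intro d
  induction d with
  | zero =>
    intro f hd _
    exact ⟨0, zero_mem A, (eq_zero_of_mem_lowDegree_zero hd).symm⟩
  | succ d ih =>
    intro f hd hf
    obtain ⟨a, ha, haf⟩ := exists_sub_homogeneousComponent_mem_lowDegree (h f hf) d
    obtain ⟨b, hb, hbf⟩ := ih (f - a 1) (by
      rw [← sub_sub_sub_cancel_right f (a 1) (homogeneousComponent d f)]
      exact sub_mem (sub_homogeneousComponent_mem_lowDegree hd) haf) fun σ => by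
        rw [map_sub, hf, permHat_apply_one_of_mem_centralizer (hA ha)]
    exact ⟨b + a, add_mem hb ha, by rw [LinearMap.add_apply, hbf, sub_add_cancel]⟩

end leadingTerms

namespace IsPuvCoeff

variable {N : ℕ} {K : Fin N → Module.End ℂ (Rzl N)}
  {m : Fin (N + 1) → Fin (N + 1) → Module.End ℂ (Rzl N)}

theorem adjoin_le_centralizer (hK : IsDunkl K) (hm : IsPuvCoeff K m) :
    Algebra.adjoin ℂ {a | ∃ i j, a = m i j}
      ≤ Subalgebra.centralizer ℂ (cherednik N K : Set (Module.End ℂ (Rzl N))) := by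
  refine Algebra.adjoin_le ?_
  rintro _ ⟨i, j, rfl⟩
  rw [SetLike.mem_coe, Subalgebra.mem_centralizer_iff]
  have h : cherednik N K ≤ Subalgebra.centralizer ℂ {m i j} := by
    refine Algebra.adjoin_le ?_
    rintro _ ((⟨k, rfl⟩ | ⟨k, rfl⟩) | ⟨σ, rfl⟩) <;>
      rw [SetLike.mem_coe, Subalgebra.mem_centralizer_iff] <;> rintro _ rfl
    · exact hm.mul_comm_of_Puv (fun u v => hK.Puv_mul_mulP u v k) i j
    · exact hm.mul_comm_of_Puv (fun u v => hK.Puv_mul_K u v k) i j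
    · exact hm.mul_comm_of_Puv (fun u v => hK.Puv_mul_permOp u v σ) i j
  exact fun g hg => ((Subalgebra.mem_centralizer_iff ℂ).1 (h hg) _ rfl).symm

theorem last_apply_one (hK : IsDunkl K) (hm : IsPuvCoeff K m) (j : Fin (N + 1)) :
    m (Fin.last N) j 1 = zCoeff N Finset.univ j := by
  have h := lCoeff_card (Finset.univ : Finset (Fin N))
  rw [Finset.card_fin] at h
  rw [hm.apply_one hK, Fin.val_last, h, one_mul, Finset.sum_eq_zero, sub_zero]
  intro l _
  rw [lCoeff_eq_zero, zero_mul]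
  simpa using Finset.card_erase_lt_of_mem (Finset.mem_univ l)

theorem apply_one_last (hK : IsDunkl K) (hm : IsPuvCoeff K m) (i : Fin (N + 1)) :
    m i (Fin.last N) 1 = lCoeff N Finset.univ i := by
  have h := zCoeff_card (Finset.univ : Finset (Fin N))
  rw [Finset.card_fin] at h
  rw [hm.apply_one hK, Fin.val_last, h, mul_one, Finset.sum_eq_zero, sub_zero]
  intro l _
  rw [zCoeff_eq_zero, mul_zero]
  simpa using Finset.card_erase_lt_of_mem (Finset.mem_univ l)

theorem last_mul_last_sub_apply_one (hK : IsDunkl K) (hm : IsPuvCoeff K m) (i j : Fin (N + 1)) :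
    (m (Fin.last N) j * m i (Fin.last N) - m i j) 1
      = ∑ l, lCoeff N (Finset.univ.erase l) i * zCoeff N (Finset.univ.erase l) j := by
  obtain ⟨hx, hy, -⟩ := mul_eq_mul_of_mem_centralizer
    (hm.adjoin_le_centralizer hK (Algebra.subset_adjoin ⟨Fin.last N, j, rfl⟩))
  rw [LinearMap.sub_apply, Module.End.mul_apply, hK.apply_eq_mul hx hy fun k l => ?_,
    hm.last_apply_one hK, hm.apply_one_last hK, hm.apply_one hK]
  · ring
  · rw [hm.last_apply_one hK, sL_zCoeff]

theorem mem_adjoin_leadingTerms (hK : IsDunkl K) (hm : IsPuvCoeff K m) {f : Rzl N}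
    (hf : ∀ σ, permHat N σ f = f) :
    f ∈ Algebra.adjoin ℂ (leadingTerms hK _ (hm.adjoin_le_centralizer hK) : Set (Rzl N)) := by
  set B := Algebra.adjoin ℂ (leadingTerms hK _ (hm.adjoin_le_centralizer hK) : Set (Rzl N))
  have hB : ∀ d g, g.IsHomogeneous d → (∃ a ∈ Algebra.adjoin ℂ {a | ∃ i j, a = m i j}, a 1 = g) →
      g ∈ B := by
    rintro d g hg ⟨a, ha, rfl⟩
    exact Algebra.subset_adjoin ⟨d, hg, a, ha, by simp⟩
  have hmem : ∀ i j, m i j ∈ Algebra.adjoin ℂ {a | ∃ i j, a = m i j} := fun i j =>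
    Algebra.subset_adjoin ⟨i, j, rfl⟩
  refine mem_of_perm_invariant B
    (sum_pow_mul_pow_mem B.toSubring (fun n => ?_) (fun n => ?_) fun n k => ?_) f hf
  · change lCoeff N Finset.univ n ∈ B
    rcases lt_or_ge N n with hn | hn
    · rw [lCoeff_eq_zero (by simpa using hn)]
      exact zero_mem B
    · exact hB (N - n) _ (lCoeff_isHomogeneous (by simp; omega))
        ⟨_, hmem _ _, hm.apply_one_last hK ⟨n, by omega⟩⟩
  · change zCoeff N Finset.univ n ∈ B
    rcases lt_or_ge N n with hn | hn
    · rw [zCoeff_eq_zero (by simpa using hn)]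
      exact zero_mem B
    · exact hB (N - n) _ (zCoeff_isHomogeneous (by simp; omega))
        ⟨_, hmem _ _, hm.last_apply_one hK ⟨n, by omega⟩⟩
  · change ∑ l, lCoeff N (Finset.univ.erase l) n * zCoeff N (Finset.univ.erase l) k ∈ B
    have hc : ∀ l : Fin N, (Finset.univ.erase l).card = N - 1 := fun l => by simp
    by_cases h : n ≤ N - 1 ∧ k ≤ N - 1
    · refine hB (N - 1 - n + (N - 1 - k)) _ (IsHomogeneous.sum _ _ _ fun l _ =>
        (lCoeff_isHomogeneous ?_).mul (zCoeff_isHomogeneous ?_))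
        ⟨_, sub_mem (mul_mem (hmem _ _) (hmem _ _)) (hmem _ _),
          hm.last_mul_last_sub_apply_one hK ⟨n, by omega⟩ ⟨k, by omega⟩⟩ <;>
      rw [hc] <;> omega
    · rw [not_and_or] at h
      rw [Finset.sum_eq_zero]
      · exact zero_mem B
      · intro l _
        rcases h with h | h
        · rw [lCoeff_eq_zero (by rw [hc]; omega), zero_mul]
        · rw [zCoeff_eq_zero (by rw [hc]; omega), mul_zero]

theorem mem_center_iff (hK : IsDunkl K) (hm : IsPuvCoeff K m) (x : Module.End ℂ (Rzl N)) :
    (x ∈ cherednik N K ∧ ∀ y ∈ cherednik N K, x * y = y * x) ↔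
      x ∈ Algebra.adjoin ℂ {a : Module.End ℂ (Rzl N) | ∃ i j, a = m i j} := by
  have hA := hm.adjoin_le_centralizer hK
  constructor
  · rintro ⟨-, hx⟩
    have hxc : x ∈ Subalgebra.centralizer ℂ (cherednik N K : Set (Module.End ℂ (Rzl N))) :=
      (Subalgebra.mem_centralizer_iff ℂ).2 fun y hy => (hx y hy).symm
    obtain ⟨a, ha, hax⟩ := exists_apply_one_eq (fun f => hm.mem_adjoin_leadingTerms hK)
      (permHat_apply_one_of_mem_centralizer hxc)
    obtain ⟨h1, h2, -⟩ := mul_eq_mul_of_mem_centralizer (sub_mem hxc (hA ha))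
    have h0 : (x - a) 1 = 0 := by rw [LinearMap.sub_apply, hax, sub_self]
    have h : x - a = 0 := LinearMap.ext fun p => by
      rw [hK.apply_eq_mul h1 h2 (fun i j => by rw [h0, map_zero]), h0, zero_mul,
        LinearMap.zero_apply]
    rwa [sub_eq_zero.1 h]
  · intro hx
    refine ⟨Algebra.adjoin_le ?_ hx, fun y hy =>
      ((Subalgebra.mem_centralizer_iff ℂ).1 (hA hx) y hy).symm⟩
    rintro _ ⟨i, j, rfl⟩
    exact hm.mem_cherednik i j

end IsPuvCoeff

set_option synthInstance.maxHeartbeats 1000000 in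
/-- The center of `H` is the unital subalgebra of `H` generated by the coefficients
`c_ij` of the universal central polynomial. -/
theorem stmt7 (N : ℕ) (hN : 0 < N)
    (D : Fin N → Fin N → Rzl N → Rzl N)
    (hD : ∀ i j : Fin N, i ≠ j → ∀ p : Rzl N,
      (X (Sum.inr i) - X (Sum.inr j)) * D i j p = p - sL N i j p)
    (K : Fin N → Module.End ℂ (Rzl N))
    (hK : ∀ (i : Fin N) (p : Rzl N),
      K i p = X (Sum.inl i) * p + ∑ j ∈ Finset.univ.erase i, sZ N i j (D i j p))
    (c : Fin (N + 1) → Fin (N + 1) → Module.End ℂ (Rzl N))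
    (hc : ∀ u v : ℂ, Puv K u v =
      ∑ i : Fin (N + 1), ∑ j : Fin (N + 1),
        (v ^ (N - (i : ℕ)) * u ^ (N - (j : ℕ))) • c i j) :
    ∀ x : Module.End ℂ (Rzl N),
      (x ∈ cherednik N K ∧ ∀ y ∈ cherednik N K, x * y = y * x) ↔
        x ∈ Algebra.adjoin ℂ {a : Module.End ℂ (Rzl N) | ∃ i j, a = c i j} := by
  intro x
  have hm : IsPuvCoeff K fun i j => c i.rev j.rev := fun u v => by
    rw [hc, ← Equiv.sum_comp Fin.revPerm]
    refine Finset.sum_congr rfl fun i _ => ?_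
    rw [← Equiv.sum_comp Fin.revPerm]
    refine Finset.sum_congr rfl fun j _ => ?_
    have h : ∀ i : Fin (N + 1), N - (i.rev : ℕ) = i := fun i => by
      rw [Fin.val_rev]; omega
    rw [Fin.revPerm_apply, Fin.revPerm_apply, h, h]
  have hset : {a | ∃ i j, a = c i j} = {a | ∃ i j : Fin (N + 1), a = c i.rev j.rev} :=
    Set.ext fun a => ⟨fun ⟨i, j, h⟩ => ⟨i.rev, j.rev, by rwa [Fin.rev_rev, Fin.rev_rev]⟩,
      fun ⟨i, j, h⟩ => ⟨i.rev, j.rev, h⟩⟩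
  rw [hset]
  exact hm.mem_center_iff ⟨D, hD, hK⟩ x
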